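/- arXiv:math/9712213 — 5 statements merged into one kernel-verified Lean document; each statement's English description precedes it below -/
import Mathlib

section
/- Let h_1, ..., h_N be nonzero linear functionals on ℝ^d and a_1, ..., a_N real numbers, and let A be the hyperplane arrangement consisting of the affine hyperplanes H_i = {x ∈ ℝ^d : h_i(x) = a_i}. Then the number of regions of A equals the sum, over all central subsets I ⊆ {1,...,N}, of (−1)^{|I| − rk(I)}; here a subset I is central if the intersection ⋂_{i∈I} H_i is nonempty (the empty set is central), and rk(I) is the dimension of the linear span of {h_i : i ∈ I}. -/
attribute [local instance] Classical.propDecidable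

/-- The number of regions of the complement of an arrangement: the number of
connected components of the set `s` (the complement of the union of the hyperplanes). -/
noncomputable def numRegions {V : Type*} [TopologicalSpace V] (s : Set V) : ℕ :=
  Nat.card (ConnectedComponents s)

section Arrangement

open Module Topology

variable {ι V : Type*} [AddCommGroup V] [Module ℝ V]

/-- The common intersection of the hyperplanes indexed by `D`. -/
def arrangementFlat (h : ι → V →ₗ[ℝ] ℝ) (a : ι → ℝ) (D : Finset ι) : Set V :=
  {x | ∀ i ∈ D, h i x = a i}

/-- The points of the flat of `C` lying strictly above the hyperplanes in `σ` and strictly below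
the other hyperplanes in `S`. -/
def arrangementCell (h : ι → V →ₗ[ℝ] ℝ) (a : ι → ℝ) (C S σ : Finset ι) : Set V :=
  {x | x ∈ arrangementFlat h a C ∧ ∀ i ∈ S, if i ∈ σ then a i < h i x else h i x < a i}

/-- The rank of a set of linear functionals of an arrangement. -/
noncomputable def arrangementRank (h : ι → V →ₗ[ℝ] ℝ) (D : Finset ι) : ℕ :=
  finrank ℝ (Submodule.span ℝ (h '' ↑D))

variable {h : ι → V →ₗ[ℝ] ℝ} {a : ι → ℝ} {C S σ D I : Finset ι} {j : ι}

lemma mem_arrangementFlat_insert {x : V} :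
    x ∈ arrangementFlat h a (insert j D) ↔ x ∈ arrangementFlat h a D ∧ h j x = a j := by
  simp [arrangementFlat, and_comm]

lemma arrangementFlat_anti {D E : Finset ι} (hDE : D ⊆ E) :
    arrangementFlat h a E ⊆ arrangementFlat h a D :=
  fun _ hx i hi => hx i (hDE hi)

lemma mem_arrangementCell_insert_flat {x : V} :
    x ∈ arrangementCell h a (insert j C) S σ ↔ x ∈ arrangementCell h a C S σ ∧ h j x = a j := by
  simp only [arrangementCell, Set.mem_ofPred_eq, mem_arrangementFlat_insert]
  tauto

lemma mem_arrangementCell_insert_below (hj : j ∉ σ) {x : V} :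
    x ∈ arrangementCell h a C (insert j S) σ ↔ x ∈ arrangementCell h a C S σ ∧ h j x < a j := by
  simp only [arrangementCell, Set.mem_ofPred_eq, Finset.forall_mem_insert, if_neg hj]
  tauto

lemma mem_arrangementCell_insert_above (hj : j ∉ S) {x : V} :
    x ∈ arrangementCell h a C (insert j S) (insert j σ) ↔
      x ∈ arrangementCell h a C S σ ∧ a j < h j x := by
  have key : (∀ i ∈ S, if i ∈ insert j σ then a i < h i x else h i x < a i) ↔
      ∀ i ∈ S, if i ∈ σ then a i < h i x else h i x < a i := by
    refine forall₂_congr fun i hi => ?_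
    have : i ≠ j := fun hij => hj (hij ▸ hi)
    simp [this]
  simp only [arrangementCell, Set.mem_ofPred_eq, Finset.forall_mem_insert, key,
    Finset.mem_insert_self, if_true]
  tauto

lemma convex_arrangementCell : Convex ℝ (arrangementCell h a C S σ) := by
  have hset : arrangementCell h a C S σ = (⋂ i ∈ C, {x | h i x = a i}) ∩
      ⋂ i ∈ S, if i ∈ σ then {x | a i < h i x} else {x | h i x < a i} := by
    ext x
    simp only [arrangementCell, arrangementFlat, Set.mem_ofPred_eq, Set.mem_inter_iff,
      Set.mem_iInter]
    refine and_congr Iff.rfl (forall₂_congr fun i _ => ?_)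
    split_ifs <;> rfl
  rw [hset]
  refine (convex_iInter₂ fun i _ => convex_hyperplane (h i).isLinear _).inter
    (convex_iInter₂ fun i _ => ?_)
  split_ifs
  · exact convex_halfSpace_gt (h i).isLinear _
  · exact convex_halfSpace_lt (h i).isLinear _

lemma eventually_add_smul_mem_arrangementCell {x y : V} (hx : x ∈ arrangementCell h a C S σ)
    (hy : y ∈ arrangementFlat h a C) :
    ∀ᶠ t in 𝓝 (0 : ℝ), x + t • (y - x) ∈ arrangementCell h a C S σ := by
  refine Filter.Eventually.and (.of_forall fun t i hi => ?_) ?_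
  · simp [show h i x = a i from hx.1 i hi, show h i y = a i from hy i hi]
  · refine (Filter.eventually_all_finset S).2 fun i hi => ?_
    have hcont : Filter.Tendsto (fun t : ℝ => h i (x + t • (y - x))) (𝓝 0) (𝓝 (h i x)) := by
      have : Continuous fun t : ℝ => h i x + t * (h i y - h i x) := by fun_prop
      simpa using this.tendsto 0
    have hxi := hx.2 i hi
    split_ifs at hxi ⊢
    · exact hcont.eventually_const_lt hxi
    · exact hcont.eventually_lt_const hxi

lemma exists_lt_and_exists_gt_of_mem_arrangementCell {x y : V}
    (hx : x ∈ arrangementCell h a C S σ) (hxj : h j x = a j) (hy : y ∈ arrangementFlat h a C)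
    (hyj : h j y ≠ a j) :
    (∃ z ∈ arrangementCell h a C S σ, h j z < a j) ∧
      ∃ z ∈ arrangementCell h a C S σ, a j < h j z := by
  obtain ⟨ε, hε, hball⟩ := Metric.eventually_nhds_iff.1
    (eventually_add_smul_mem_arrangementCell hx hy)
  have hpos := hball (y := ε / 2) (by simp [abs_of_pos hε, hε])
  have hneg := hball (y := -(ε / 2)) (by simp [abs_of_pos hε, hε])
  have hval (t : ℝ) : h j (x + t • (y - x)) = a j + t * (h j y - a j) := by simp [hxj]
  rcases lt_or_gt_of_ne hyj with hlt | hgt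
  · exact ⟨⟨_, hpos, by rw [hval]; nlinarith⟩, _, hneg, by rw [hval]; nlinarith⟩
  · exact ⟨⟨_, hneg, by rw [hval]; nlinarith⟩, _, hpos, by rw [hval]; nlinarith⟩

lemma exists_eq_of_lt_of_gt_mem_arrangementCell {x z : V}
    (hx : x ∈ arrangementCell h a C S σ) (hxj : h j x < a j)
    (hz : z ∈ arrangementCell h a C S σ) (hzj : a j < h j z) :
    ∃ w ∈ arrangementCell h a C S σ, h j w = a j := by
  have hd : 0 < h j z - h j x := by linarith
  refine ⟨_, convex_arrangementCell.add_smul_sub_mem hx hz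
    (t := (a j - h j x) / (h j z - h j x)) ⟨by apply div_nonneg <;> linarith,
      (div_le_one hd).2 (by linarith)⟩, ?_⟩
  simp only [map_add, map_smul, map_sub, smul_eq_mul]
  rw [div_mul_cancel₀ _ hd.ne']
  ring

lemma ite_add_ite_eq_ite_or_add_ite_and {p q r s : Prop} [Decidable p] [Decidable q]
    [Decidable r] [Decidable s] (hr : r ↔ p ∨ q) (hs : s ↔ p ∧ q) :
    ((if p then 1 else 0 : ℤ) + if q then 1 else 0) =
      (if r then 1 else 0) + if s then 1 else 0 := by
  by_cases hp : p <;> by_cases hq : q <;> simp [hr, hs, hp, hq]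

/-- Adding a hyperplane splits exactly those cells which it meets. -/
lemma ite_nonempty_arrangementCell_insert (hjS : j ∉ S) (hσ : σ ⊆ S)
    (hC : ∃ y ∈ arrangementFlat h a C, h j y ≠ a j) :
    ((if (arrangementCell h a C (insert j S) σ).Nonempty then 1 else 0 : ℤ) +
      if (arrangementCell h a C (insert j S) (insert j σ)).Nonempty then 1 else 0) =
    (if (arrangementCell h a C S σ).Nonempty then 1 else 0) +
      if (arrangementCell h a (insert j C) S σ).Nonempty then 1 else 0 := by
  obtain ⟨y, hy, hyj⟩ := hC
  simp only [Set.Nonempty, mem_arrangementCell_insert_flat, mem_arrangementCell_insert_above hjS,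
    mem_arrangementCell_insert_below (fun hj => hjS (hσ hj))]
  have hsplit : (∃ x, x ∈ arrangementCell h a C S σ) →
      (∃ x ∈ arrangementCell h a C S σ, h j x < a j) ∨
        ∃ x ∈ arrangementCell h a C S σ, a j < h j x := by
    rintro ⟨x, hx⟩
    rcases lt_trichotomy (h j x) (a j) with hlt | heq | hgt
    · exact .inl ⟨x, hx, hlt⟩
    · exact .inl (exists_lt_and_exists_gt_of_mem_arrangementCell hx heq hy hyj).1
    · exact .inr ⟨x, hx, hgt⟩
  have hmeet : (∃ x ∈ arrangementCell h a C S σ, h j x = a j) ↔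
      (∃ x ∈ arrangementCell h a C S σ, h j x < a j) ∧
        ∃ x ∈ arrangementCell h a C S σ, a j < h j x := by
    constructor
    · rintro ⟨x, hx, hxj⟩
      exact exists_lt_and_exists_gt_of_mem_arrangementCell hx hxj hy hyj
    · rintro ⟨⟨x, hx, hxj⟩, z, hz, hzj⟩
      exact exists_eq_of_lt_of_gt_mem_arrangementCell hx hxj hz hzj
  refine ite_add_ite_eq_ite_or_add_ite_and ⟨hsplit, ?_⟩ hmeet
  rintro (⟨x, hx, _⟩ | ⟨x, hx, _⟩) <;> exact ⟨x, hx⟩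

lemma arrangementRank_insert_of_forall (hD : (arrangementFlat h a D).Nonempty)
    (hj : ∀ x ∈ arrangementFlat h a D, h j x = a j) :
    arrangementRank h (insert j D) = arrangementRank h D := by
  obtain ⟨x, hx⟩ := hD
  have hmem : h j ∈ Submodule.span ℝ (h '' ↑D) := by
    rw [Set.image_eq_range]
    refine mem_span_of_iInf_ker_le_ker fun v hv => ?_
    have hv' : ∀ i ∈ D, h i v = 0 := by simpa using hv
    have hxv := hj (x + v) fun i hi => by simp [hx i hi, hv' i hi]
    simpa [hj x hx] using hxv
  rw [arrangementRank, arrangementRank, Finset.coe_insert, Set.image_insert_eq,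
    Submodule.span_insert_eq_span hmem]

lemma arrangementRank_insert_of_exists [FiniteDimensional ℝ V]
    (hD : (arrangementFlat h a (insert j D)).Nonempty)
    (hj : ∃ y ∈ arrangementFlat h a D, h j y ≠ a j) :
    arrangementRank h (insert j D) = arrangementRank h D + 1 := by
  obtain ⟨x, hx⟩ := hD
  obtain ⟨y, hy, hyj⟩ := hj
  rw [mem_arrangementFlat_insert] at hx
  have hmem : h j ∉ Submodule.span ℝ (h '' ↑D) := by
    intro hmem
    have hle : Submodule.span ℝ (h '' ↑D) ≤
        LinearMap.ker (LinearMap.applyₗ (R := ℝ) (M₂ := ℝ) (y - x)) := by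
      rw [Submodule.span_le]
      rintro _ ⟨i, hi, rfl⟩
      simp [show h i x = a i from hx.1 i hi, show h i y = a i from hy i hi]
    have := hle hmem
    rw [LinearMap.mem_ker, LinearMap.applyₗ_apply_apply, map_sub, hx.2] at this
    exact hyj (sub_eq_zero.1 this)
  rw [arrangementRank, arrangementRank, Finset.coe_insert, Set.image_insert_eq,
    Submodule.span_insert, sup_comm]
  exact Submodule.finrank_sup_span_singleton hmem

/-- Whitney's formula for the number of cells of the arrangement induced by the hyperplanes in `S`
on the flat of `C`. -/
lemma sum_nonempty_arrangementCell [FiniteDimensional ℝ V] (h : ι → V →ₗ[ℝ] ℝ) (a : ι → ℝ)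
    (S C : Finset ι) :
    ∑ σ ∈ S.powerset, (if (arrangementCell h a C S σ).Nonempty then 1 else 0 : ℤ) =
      ∑ I ∈ S.powerset, if (arrangementFlat h a (C ∪ I)).Nonempty then
        (-1 : ℤ) ^ (I.card + arrangementRank h C + arrangementRank h (C ∪ I)) else 0 := by
  induction S using Finset.induction_on generalizing C with
  | empty => simp [arrangementCell, ← two_mul, pow_mul]
  | insert j S hjS ih =>
    rw [Finset.sum_powerset_insert hjS, Finset.sum_powerset_insert hjS]
    by_cases hC : ∃ y ∈ arrangementFlat h a C, h j y ≠ a j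
    · rw [← Finset.sum_add_distrib, Finset.sum_congr rfl fun σ hσ =>
        ite_nonempty_arrangementCell_insert hjS (Finset.mem_powerset.1 hσ) hC,
        Finset.sum_add_distrib, ih, ih]
      congr 1
      refine Finset.sum_congr rfl fun I hI => ?_
      have hjI : j ∉ I := fun hj => hjS (Finset.mem_powerset.1 hI hj)
      rw [Finset.insert_union, ← Finset.union_insert]
      split_ifs with hne
      · rw [arrangementRank_insert_of_exists (hne.mono (arrangementFlat_anti (by grind))) hC,
          Finset.card_insert_of_notMem hjI]
        congr 1
        ring
      · rfl
    · push Not at hC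
      rw [← Finset.sum_add_distrib, ← Finset.sum_add_distrib]
      refine (Finset.sum_eq_zero fun σ hσ => ?_).trans
        (Finset.sum_eq_zero fun I hI => ?_).symm
      · have hjσ : j ∉ σ := fun hj => hjS (Finset.mem_powerset.1 hσ hj)
        rw [if_neg, if_neg, add_zero]
        · rintro ⟨x, hx⟩
          rw [mem_arrangementCell_insert_above hjS] at hx
          exact hx.2.ne' (hC x hx.1.1)
        · rintro ⟨x, hx⟩
          rw [mem_arrangementCell_insert_below hjσ] at hx
          exact hx.2.ne (hC x hx.1.1)
      · have hjI : j ∉ I := fun hj => hjS (Finset.mem_powerset.1 hI hj)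
        have hCI : ∀ x ∈ arrangementFlat h a (C ∪ I), h j x = a j := fun x hx =>
          hC x (arrangementFlat_anti Finset.subset_union_left hx)
        have hflat : arrangementFlat h a (insert j (C ∪ I)) = arrangementFlat h a (C ∪ I) := by
          ext x
          rw [mem_arrangementFlat_insert, and_iff_left_of_imp (hCI x)]
        rw [Finset.union_insert, hflat]
        split_ifs with hne
        · rw [arrangementRank_insert_of_forall hne hCI, Finset.card_insert_of_notMem hjI]
          ring
        · rfl

lemma arrangementRank_le_card (h : ι → V →ₗ[ℝ] ℝ) (D : Finset ι) :
    arrangementRank h D ≤ D.card := by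
  rw [arrangementRank, ← Finset.coe_image]
  exact (finrank_span_finset_le_card _).trans Finset.card_image_le

end Arrangement

/-- A continuous map with preconnected fibres to a discrete space identifies the connected
components of its source with its range. -/
lemma natCard_connectedComponents_eq_ncard_range {X Y : Type*} [TopologicalSpace X]
    [TopologicalSpace Y] [DiscreteTopology Y] {f : X → Y} (hf : Continuous f)
    (hfib : ∀ y, IsPreconnected (f ⁻¹' {y})) :
    Nat.card (ConnectedComponents X) = (Set.range f).ncard := by
  have hinj : Function.Injective hf.connectedComponentsLift := by
    intro p q hpq
    obtain ⟨x, rfl⟩ := ConnectedComponents.surjective_coe p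
    obtain ⟨y, rfl⟩ := ConnectedComponents.surjective_coe q
    rw [ConnectedComponents.coe_eq_coe']
    exact (hfib (f y)).subset_connectedComponent rfl hpq
  have hrange : Set.range hf.connectedComponentsLift = Set.range f := by
    rw [← ConnectedComponents.surjective_coe.range_comp, hf.connectedComponentsLift_comp_coe]
  rw [← hrange, ← Nat.card_coe_set_eq, Nat.card_range_of_injective hinj]

/-- The regions of an arrangement correspond to its nonempty cells. -/
lemma numRegions_eq_sum_nonempty_arrangementCell {ι V : Type*} [Fintype ι] [AddCommGroup V]
    [Module ℝ V] [TopologicalSpace V] [ContinuousAdd V] [ContinuousSMul ℝ V]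
    (h : ι → V →ₗ[ℝ] ℝ) (hcont : ∀ i, Continuous (h i)) (a : ι → ℝ) :
    (numRegions {x : V | ∀ i, h i x ≠ a i} : ℤ) =
      ∑ σ ∈ (Finset.univ : Finset ι).powerset,
        if (arrangementCell h a ∅ Finset.univ σ).Nonempty then 1 else 0 := by
  let _ : TopologicalSpace (Finset ι) := ⊥
  have : DiscreteTopology (Finset ι) := ⟨rfl⟩
  let f : {x : V | ∀ i, h i x ≠ a i} → Finset ι := fun x => {i | a i < h i x}
  have hcell (x : {x : V | ∀ i, h i x ≠ a i}) (σ : Finset ι) :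
      f x = σ ↔ (x : V) ∈ arrangementCell h a ∅ Finset.univ σ := by
    have hx := x.2
    simp only [f, arrangementCell, arrangementFlat, Finset.ext_iff, Finset.mem_filter_univ,
      Set.mem_ofPred_eq, Finset.notMem_empty, IsEmpty.forall_iff, implies_true, true_and,
      Finset.mem_univ, forall_const]
    refine forall_congr' fun i => ?_
    have := hx i
    split_ifs with hi
    · simp [hi]
    · simp only [hi, iff_false, not_lt]
      exact ⟨fun hle => lt_of_le_of_ne hle this, le_of_lt⟩
  have hsub (σ : Finset ι) :
      arrangementCell h a ∅ Finset.univ σ ⊆ {x : V | ∀ i, h i x ≠ a i} := by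
    intro x hx i
    have := hx.2 i (Finset.mem_univ i)
    split_ifs at this
    exacts [this.ne', this.ne]
  have hf : Continuous f := by
    refine IsLocallyConstant.continuous ((IsLocallyConstant.iff_eventually_eq f).2 fun x => ?_)
    have hev : ∀ i, ∀ᶠ y : {x : V | ∀ i, h i x ≠ a i} in nhds x,
        (a i < h i y ↔ a i < h i x) := by
      intro i
      have ht : Filter.Tendsto (fun y : {x : V | ∀ i, h i x ≠ a i} => h i y) (nhds x)
          (nhds (h i x)) := ((hcont i).comp continuous_subtype_val).tendsto x
      rcases lt_or_gt_of_ne (x.2 i) with hlt | hgt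
      · filter_upwards [ht.eventually_lt_const hlt] with y hy
        exact iff_of_false hy.not_gt hlt.not_gt
      · filter_upwards [ht.eventually_const_lt hgt] with y hy
        exact iff_of_true hy hgt
    filter_upwards [Filter.eventually_all.2 hev] with y hy
    simp [f, hy]
  have hfib (σ : Finset ι) : IsPreconnected (f ⁻¹' {σ}) := by
    have himage : Subtype.val '' (f ⁻¹' {σ}) = arrangementCell h a ∅ Finset.univ σ := by
      ext x
      constructor
      · rintro ⟨y, hy, rfl⟩
        exact (hcell y σ).1 hy
      · intro hx
        exact ⟨⟨x, hsub σ hx⟩, (hcell ⟨x, hsub σ hx⟩ σ).2 hx, rfl⟩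
    rw [← Topology.IsInducing.subtypeVal.isPreconnected_image, himage]
    exact convex_arrangementCell.isPreconnected
  have hrange : Set.range f =
      ({σ | (arrangementCell h a ∅ Finset.univ σ).Nonempty} : Finset (Finset ι)) := by
    ext σ
    simp only [Set.mem_range, Finset.coe_filter, Finset.mem_univ, true_and, Set.mem_ofPred_eq]
    constructor
    · rintro ⟨x, hx⟩
      exact ⟨x, (hcell x σ).1 hx⟩
    · rintro ⟨x, hx⟩
      exact ⟨⟨x, hsub σ hx⟩, (hcell ⟨x, hsub σ hx⟩ σ).2 hx⟩
  rw [numRegions, natCard_connectedComponents_eq_ncard_range hf hfib, hrange,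
    Set.ncard_coe_finset, Finset.card_filter, Finset.powerset_univ]
  push_cast
  rfl

/-- Whitney's formula for the number of regions of an arrangement. -/
lemma numRegions_eq_sum_nonempty_arrangementFlat {ι V : Type*} [Fintype ι] [AddCommGroup V]
    [Module ℝ V] [FiniteDimensional ℝ V] [TopologicalSpace V] [ContinuousAdd V]
    [ContinuousSMul ℝ V] (h : ι → V →ₗ[ℝ] ℝ) (hcont : ∀ i, Continuous (h i)) (a : ι → ℝ) :
    (numRegions {x : V | ∀ i, h i x ≠ a i} : ℤ) =
      ∑ I : Finset ι, if (arrangementFlat h a I).Nonempty then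
        (-1 : ℤ) ^ (I.card - arrangementRank h I) else 0 := by
  rw [numRegions_eq_sum_nonempty_arrangementCell h hcont a, sum_nonempty_arrangementCell,
    Finset.powerset_univ]
  refine Finset.sum_congr rfl fun I _ => ?_
  have hempty : arrangementRank h ∅ = 0 := Nat.le_zero.1 (arrangementRank_le_card h ∅)
  rw [Finset.empty_union, hempty, add_zero]
  refine if_congr Iff.rfl ?_ rfl
  obtain ⟨k, hk⟩ := Nat.exists_eq_add_of_le (arrangementRank_le_card h I)
  rw [hk, Nat.add_sub_cancel_left, add_right_comm, ← two_mul, pow_add, pow_mul]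
  simp

/-- Whitney-type formula: the number of regions of the arrangement `h i x = a i`
equals the sum over central subsets `I` of `(-1)^(|I| - rk I)`. -/
theorem stmt0 (d N : ℕ) (h : Fin N → ((Fin d → ℝ) →ₗ[ℝ] ℝ)) (hne : ∀ i, h i ≠ 0)
    (a : Fin N → ℝ) :
    (numRegions {x : Fin d → ℝ | ∀ i, h i x ≠ a i} : ℤ) =
      ∑ I : Finset (Fin N),
        if (⋂ i ∈ I, {x : Fin d → ℝ | h i x = a i}).Nonempty then
          (-1 : ℤ) ^ (I.card - Module.finrank ℝ (Submodule.span ℝ (h '' ↑I)))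
        else 0 := by
  rw [numRegions_eq_sum_nonempty_arrangementFlat h
    (fun i => (h i).continuous_of_finiteDimensional) a]
  refine Finset.sum_congr rfl fun I _ => ?_
  have hflat : (⋂ i ∈ I, {x : Fin d → ℝ | h i x = a i}) = arrangementFlat h a I := by
    ext x
    simp [arrangementFlat]
  rw [hflat]
  rfl
end

section
/- Let P_n ⊂ ℝ^n be the permutohedron, the convex hull of the n! points (σ(1), σ(2), ..., σ(n)) as σ ranges over all permutations of {1,...,n}. Then the number of integer points in P_n (i.e., points of ℤ^n lying in P_n) equals the number of forests on n labelled vertices, i.e., the number of simple graphs on the vertex set {1,...,n} containing no cycle. -/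
namespace Permutohedron

open Finset

variable {V : Type*} [Fintype V] [DecidableEq V]

/-- The set of score vectors (in-degree vectors) of all orientations of the multigraph with
edge list `L`. -/
def scores : List (V × V) → Finset (V → ℤ)
  | [] => {0}
  | e :: L => (scores L).image (· + Pi.single e.1 1) ∪ (scores L).image (· + Pi.single e.2 1)

/-- The number of edges of `L` with both endpoints in `A`. -/
def edgesIn (A : Finset V) : List (V × V) → ℤ
  | [] => 0
  | e :: L => edgesIn A L + if e.1 ∈ A ∧ e.2 ∈ A then 1 else 0

lemma mem_scores_cons {e : V × V} {L : List (V × V)} {d : V → ℤ} :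
    d ∈ scores (e :: L) ↔ d - Pi.single e.1 1 ∈ scores L ∨ d - Pi.single e.2 1 ∈ scores L := by
  simp only [scores, mem_union, mem_image, ← eq_sub_iff_add_eq, exists_eq_right]

omit [Fintype V] in
lemma sum_sub_single (A : Finset V) (d : V → ℤ) (i : V) :
    ∑ k ∈ A, (d - Pi.single i 1 : V → ℤ) k = ∑ k ∈ A, d k - if i ∈ A then 1 else 0 := by
  simp [Finset.sum_sub_distrib, Finset.sum_pi_single']

omit [Fintype V] in
lemma edgesIn_add_le (A B : Finset V) (L : List (V × V)) :
    edgesIn A L + edgesIn B L ≤ edgesIn (A ∪ B) L + edgesIn (A ∩ B) L := by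
  induction L with
  | nil => simp [edgesIn]
  | cons e L ih =>
    simp only [edgesIn, mem_union, mem_inter]
    by_cases h1 : e.1 ∈ A <;> by_cases h2 : e.2 ∈ A <;> by_cases h3 : e.1 ∈ B <;>
      by_cases h4 : e.2 ∈ B <;> simp [h1, h2, h3, h4] <;> linarith

/-- Hakimi's theorem: score vectors of orientations are characterised by Landau's inequalities. -/
theorem mem_scores_iff {L : List (V × V)} {d : V → ℤ} :
    d ∈ scores L ↔ ∑ k, d k = edgesIn univ L ∧ ∀ A, edgesIn A L ≤ ∑ k ∈ A, d k := by
  induction L generalizing d with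
  | nil =>
    simp only [scores, mem_singleton, edgesIn]
    constructor
    · rintro rfl
      simp
    · rintro ⟨h, hA⟩
      have h0 : ∀ k, 0 ≤ d k := fun k => by simpa using hA {k}
      ext k
      exact (Finset.sum_eq_zero_iff_of_nonneg fun k _ => h0 k).1 h k (mem_univ k)
  | cons e L ih =>
    obtain ⟨i, j⟩ := e
    simp only [mem_scores_cons, ih, edgesIn, sum_sub_single, mem_univ, if_true, and_self]
    constructor
    · rintro (⟨h, hA⟩ | ⟨h, hA⟩) <;> refine ⟨by linarith, fun A => ?_⟩ <;>
      · have := hA A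
        by_cases h1 : i ∈ A <;> by_cases h2 : j ∈ A <;> simp [h1, h2] at this ⊢ <;> linarith
    · rintro ⟨h, hA⟩
      by_contra! hcon
      obtain ⟨A, hA'⟩ := hcon.1 (by linarith)
      obtain ⟨B, hB'⟩ := hcon.2 (by linarith)
      have h1 := hA A
      have h2 := hA B
      have h3 := hA (A ∪ B)
      have h4 := hA (A ∩ B)
      have h5 := edgesIn_add_le A B L
      have h6 := Finset.sum_union_inter (s₁ := A) (s₂ := B) (f := d)
      simp only [mem_union, mem_inter] at h3 h4
      by_cases hi : i ∈ A <;> by_cases hj : j ∈ A <;> by_cases hi' : i ∈ B <;>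
        by_cases hj' : j ∈ B <;> simp [hi, hj, hi', hj'] at hA' hB' h1 h2 h3 h4 <;> linarith

lemma mem_scores_of_between {L : List (V × V)} {x : V → ℤ} {i j : V} {m : ℤ} (hm : 1 ≤ m)
    (hx : x ∈ scores L) (hxm : x + m • (Pi.single i 1 - Pi.single j 1) ∈ scores L) :
    x + (Pi.single i 1 - Pi.single j 1) ∈ scores L := by
  rw [mem_scores_iff] at *
  simp only [Pi.add_apply, Pi.sub_apply, Pi.smul_apply, sum_add_distrib, ← smul_sum,
    sum_sub_distrib, sum_pi_single', mem_univ, if_true, sub_self, smul_zero, add_zero] at *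
  refine ⟨hx.1, fun A => ?_⟩
  have h1 := hx.2 A
  have h2 := hxm.2 A
  by_cases hi : i ∈ A <;> by_cases hj : j ∈ A <;> simp [hi, hj] at h1 h2 ⊢ <;> linarith

/-- The map on vertices which merges `j` into `i`. -/
def merge (i j : V) : V → V := Function.update id j i

/-- The map on score vectors induced by merging `j` into `i`. -/
def push (i j : V) (x : V → ℤ) : V → ℤ := x + x j • (Pi.single i 1 - Pi.single j 1)

omit [Fintype V] in
lemma push_add_single (i j a : V) (x : V → ℤ) :
    push i j (x + Pi.single a 1) = push i j x + Pi.single (merge i j a) 1 := by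
  by_cases h : a = j
  · subst h
    simp only [push, merge, Function.update_self, Pi.add_apply, Pi.single_eq_same]
    rw [add_smul, one_smul]; abel
  · simp only [push, merge, Function.update_of_ne h, Pi.add_apply,
      Pi.single_eq_of_ne (Ne.symm h), id_eq, add_zero]
    abel

lemma scores_map_merge (i j : V) (L : List (V × V)) :
    scores (L.map (Prod.map (merge i j) (merge i j))) = (scores L).image (push i j) := by
  induction L with
  | nil => simp [scores, push]
  | cons e L ih =>
    simp only [List.map_cons, scores, ih, image_union, image_image, Prod.map_fst, Prod.map_snd]
    congr 1 <;>
    · refine image_congr fun x _ => ?_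
      simp [push_add_single]

omit [Fintype V] in
lemma push_eq_iff {i j : V} {x y : V → ℤ} :
    push i j x = push i j y ↔ y = x + (x j - y j) • (Pi.single i 1 - Pi.single j 1) := by
  unfold push
  rw [sub_smul]
  constructor
  · intro h
    linear_combination -h
  · intro h
    linear_combination -h

lemma card_filter_top {i j : V} (hij : i ≠ j) (L : List (V × V)) :
    #{x ∈ scores L | x + (Pi.single i 1 - Pi.single j 1) ∉ scores L} =
      #((scores L).image (push i j)) := by
  rw [← card_image_of_injOn (f := push i j)]
  · congr 1
    ext y
    simp only [mem_image, mem_filter]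
    constructor
    · rintro ⟨x, hx, rfl⟩
      exact ⟨x, hx.1, rfl⟩
    · rintro ⟨x, hx, rfl⟩
      obtain ⟨z, hz, hmax⟩ := exists_max_image {z ∈ scores L | push i j z = push i j x}
        (fun z => z i) ⟨x, by simp [hx]⟩
      simp only [mem_filter] at hz hmax
      refine ⟨z, ⟨hz.1, fun h => ?_⟩, hz.2⟩
      have := hmax _ ⟨h, ?_⟩
      · simp [Pi.single_eq_of_ne hij] at this
      · rw [← hz.2]
        symm
        rw [push_eq_iff]
        simp [Pi.single_eq_of_ne hij.symm]
  · have key : ∀ x ∈ scores L, ∀ y ∈ scores L,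
        x + (Pi.single i 1 - Pi.single j 1) ∉ scores L →
        push i j x = push i j y → x j ≤ y j := by
      intro x hx y hy hx' h
      rw [push_eq_iff] at h
      by_contra! hlt
      exact hx' (mem_scores_of_between (m := x j - y j) (by linarith) hx (h ▸ hy))
    intro x hx y hy h
    simp only [coe_filter, Set.mem_ofPred_eq] at hx hy
    have h1 := key x hx.1 y hy.1 hx.2 h
    have h2 := key y hy.1 x hx.1 hy.2 h.symm
    have h3 := (push_eq_iff).1 h
    rw [le_antisymm h1 h2, sub_self, zero_smul, add_zero] at h3
    exact h3.symm

/-- Deletion-contraction for the number of score vectors. -/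
theorem card_scores_cons {i j : V} (hij : i ≠ j) (L : List (V × V)) :
    #(scores ((i, j) :: L)) =
      #(scores L) + #(scores (L.map (Prod.map (merge i j) (merge i j)))) := by
  have h : (scores L).image (· + Pi.single i 1) \ (scores L).image (· + Pi.single j 1) =
      image (· + Pi.single i 1)
        {x ∈ scores L | x + (Pi.single i 1 - Pi.single j 1) ∉ scores L} := by
    ext x
    simp only [mem_sdiff, mem_image, ← eq_sub_iff_add_eq, exists_eq_right, mem_filter]
    simp [add_sub]
  rw [scores_map_merge, ← card_filter_top hij, scores, ← card_sdiff_add_card, h,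
    card_image_of_injective _ (add_left_injective _),
    card_image_of_injective _ (add_left_injective _), add_comm]

lemma card_scores_cons_self (i : V) (L : List (V × V)) :
    #(scores ((i, i) :: L)) = #(scores L) := by
  rw [scores, union_self, card_image_of_injective _ (add_left_injective _)]

/-- The simple graph with edge list `L`. -/
def listGraph : List (V × V) → SimpleGraph V
  | [] => ⊥
  | e :: L => SimpleGraph.edge e.1 e.2 ⊔ listGraph L

omit [Fintype V] [DecidableEq V] in
lemma listGraph_adj {L : List (V × V)} {a b : V} :
    (listGraph L).Adj a b ↔ a ≠ b ∧ ∃ e ∈ L, s(e.1, e.2) = s(a, b) := by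
  induction L with
  | nil => simp [listGraph]
  | cons e L ih =>
    simp only [listGraph, SimpleGraph.sup_adj, ih, SimpleGraph.adj_edge, List.exists_mem_cons_iff]
    tauto

omit [Fintype V] in
lemma merge_eq_iff_reachable_sup_edge {H : SimpleGraph V} {f : V → V}
    (hf : ∀ a b, f a = f b ↔ H.Reachable a b) {i j : V} (hij : i ≠ j) (a b : V) :
    merge (f i) (f j) (f a) = merge (f i) (f j) (f b) ↔
      (H ⊔ SimpleGraph.edge i j).Reachable a b := by
  have hadj : (H ⊔ SimpleGraph.edge i j).Reachable i j :=
    SimpleGraph.Adj.reachable (by simp [SimpleGraph.edge_adj, hij])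
  have hle : ∀ {u v}, f u = f v → (H ⊔ SimpleGraph.edge i j).Reachable u v :=
    fun h => ((hf _ _).1 h).mono le_sup_left
  constructor
  · intro h
    simp only [merge, Function.update_apply, id_eq] at h
    split_ifs at h with h1 h2 h2
    · exact hle (h1.trans h2.symm)
    · exact (hle h1).trans (hadj.symm.trans (hle h))
    · exact (hle h).trans (hadj.trans (hle h2.symm))
    · exact hle h
  · rintro ⟨p⟩
    induction p with
    | nil => rfl
    | cons h p ih =>
      rw [← ih]
      rw [SimpleGraph.sup_adj, SimpleGraph.edge_adj] at h
      rcases h with h | ⟨⟨rfl, rfl⟩ | ⟨rfl, rfl⟩, -⟩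
      · rw [(hf _ _).2 h.reachable]
      · simp [merge, Function.update_apply]
      · simp [merge, Function.update_apply]

/-- Score vectors of a contracted graph are equinumerous with the forests extending the
contracted forest. -/
theorem card_scores_eq_ncard_acyclic (L : List (V × V)) (H : SimpleGraph V) (f : V → V)
    (hH : H.IsAcyclic) (hf : ∀ a b, f a = f b ↔ H.Reachable a b)
    (hL : L.Pairwise fun e e' => s(e.1, e.2) ≠ s(e'.1, e'.2))
    (hLH : ∀ e ∈ L, e.1 ≠ e.2 ∧ ¬ H.Adj e.1 e.2) :
    #(scores (L.map (Prod.map f f))) =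
      {G : SimpleGraph V | H ≤ G ∧ G ≤ H ⊔ listGraph L ∧ G.IsAcyclic}.ncard := by
  induction L generalizing H f with
  | nil =>
    have : {G : SimpleGraph V | H ≤ G ∧ G ≤ H ⊔ listGraph [] ∧ G.IsAcyclic} = {H} := by
      ext G
      simp only [listGraph, sup_bot_eq, Set.mem_ofPred_eq, Set.mem_singleton_iff]
      exact ⟨fun h => le_antisymm h.2.1 h.1, by rintro rfl; exact ⟨le_rfl, le_rfl, hH⟩⟩
    rw [this]
    simp [scores]
  | cons e L ih =>
    obtain ⟨i, j⟩ := e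
    rw [List.pairwise_cons] at hL
    obtain ⟨hij, hHij⟩ := hLH (i, j) (by simp)
    have hLH' : ∀ e ∈ L, e.1 ≠ e.2 ∧ ¬ H.Adj e.1 e.2 := fun e he => hLH e (by simp [he])
    simp only at hij hHij
    have hnot : ¬ (H ⊔ listGraph L).Adj i j := by
      rw [SimpleGraph.sup_adj, listGraph_adj]
      rintro (h | ⟨-, e, he, h⟩)
      · exact hHij h
      · exact hL.1 e he h.symm
    have hsplit : {G : SimpleGraph V | H ≤ G ∧ G ≤ H ⊔ listGraph ((i, j) :: L) ∧ G.IsAcyclic} =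
        {G : SimpleGraph V | H ≤ G ∧ G ≤ H ⊔ listGraph L ∧ G.IsAcyclic} ∪
        {G : SimpleGraph V | H ⊔ SimpleGraph.edge i j ≤ G ∧
          G ≤ H ⊔ SimpleGraph.edge i j ⊔ listGraph L ∧ G.IsAcyclic} := by
      ext G
      simp only [listGraph, Set.mem_union, Set.mem_ofPred_eq, sup_le_iff,
        SimpleGraph.edge_le_iff, hij, false_or, ← sup_assoc]
      by_cases hG : G.Adj i j
      · have : ¬ G ≤ H ⊔ listGraph L := fun h => hnot (h hG)
        tauto
      · have : G ≤ H ⊔ SimpleGraph.edge i j ⊔ listGraph L ↔ G ≤ H ⊔ listGraph L := by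
          rw [sup_right_comm]
          refine ⟨fun h a b hab => ?_, fun h => h.trans le_sup_left⟩
          have h' := h hab
          rw [SimpleGraph.sup_adj, SimpleGraph.edge_adj] at h'
          rcases h' with h' | ⟨⟨rfl, rfl⟩ | ⟨rfl, rfl⟩, -⟩
          · exact h'
          · exact absurd hab hG
          · exact absurd hab.symm hG
        tauto
    rw [hsplit, List.map_cons, Prod.map_apply]
    by_cases hr : H.Reachable i j
    · have : {G : SimpleGraph V | H ⊔ SimpleGraph.edge i j ≤ G ∧
          G ≤ H ⊔ SimpleGraph.edge i j ⊔ listGraph L ∧ G.IsAcyclic} = ∅ := by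
        rw [Set.eq_empty_iff_forall_notMem]
        rintro G ⟨h1, -, h2⟩
        have := (SimpleGraph.isAcyclic_sup_fromEdgeSet_iff.1 (h2.anti h1)).2 hr
        tauto
      rw [this, Set.union_empty, (hf i j).2 hr, card_scores_cons_self]
      exact ih H f hH hf hL.2 hLH'
    · rw [card_scores_cons (fun h => hr ((hf i j).1 h)), Set.ncard_union_eq, ih H f hH hf hL.2 hLH',
        List.map_map, Prod.map_comp_map, ih (H ⊔ SimpleGraph.edge i j) (merge (f i) (f j) ∘ f)
          (hH.sup_edge_of_not_reachable hr) (merge_eq_iff_reachable_sup_edge hf hij) hL.2]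
      · intro e he
        refine ⟨(hLH' e he).1, ?_⟩
        rw [SimpleGraph.sup_adj, SimpleGraph.adj_edge]
        rintro (h | h)
        · exact (hLH' e he).2 h
        · exact hL.1 e he h.1
      · rw [Set.disjoint_left]
        rintro G ⟨-, h1, -⟩ ⟨h2, -⟩
        exact hnot (h1 (h2 (by simp [SimpleGraph.edge_adj, hij])))

omit [Fintype V] in
lemma edgesIn_toList (A : Finset V) (s : Finset (V × V)) :
    edgesIn A s.toList = ∑ p ∈ s, if p.1 ∈ A ∧ p.2 ∈ A then 1 else 0 := by
  rw [← sum_map_toList]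
  induction s.toList with
  | nil => rfl
  | cons e L ih => rw [edgesIn, ih, List.map_cons, List.sum_cons, add_comm]

lemma sum_mul_le_of_mem_scores (a : V → ℝ) {L : List (V × V)} {d : V → ℤ} (hd : d ∈ scores L) :
    ∑ k, a k * d k ≤ (L.map fun e => max (a e.1) (a e.2)).sum := by
  induction L generalizing d with
  | nil =>
    simp only [scores, mem_singleton] at hd
    simp [hd]
  | cons e L ih =>
    have key : ∀ i, ∑ k, a k * ((d - Pi.single i 1 : V → ℤ) k : ℤ) = ∑ k, a k * d k - a i := by
      intro i
      simp [mul_sub, sum_sub_distrib, Pi.single_apply]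
    rw [List.map_cons, List.sum_cons]
    rcases mem_scores_cons.1 hd with h | h
    · have := ih h
      rw [key] at this
      linarith [le_max_left (a e.1) (a e.2)]
    · have := ih h
      rw [key] at this
      linarith [le_max_right (a e.1) (a e.2)]

variable {n : ℕ}

lemma two_mul_sum_lt (σ : Equiv.Perm (Fin n)) (g : Fin n × Fin n → ℝ)
    (hg : ∀ p, g p.swap = g p) :
    2 * ∑ p with σ p.1 < σ p.2, g p = ∑ p with p.1 ≠ p.2, g p := by
  have h1 : ∑ p with σ p.2 < σ p.1, g p = ∑ p with σ p.1 < σ p.2, g p :=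
    sum_equiv (Equiv.prodComm _ _) (by simp) (fun p _ => (hg p).symm)
  rw [two_mul]
  nth_rw 2 [← h1]
  rw [← sum_union]
  · congr 1
    ext p
    simp only [mem_union, mem_filter, mem_univ, true_and, lt_or_lt_iff_ne, σ.injective.ne_iff]
  · rw [disjoint_filter]
    exact fun p _ h => h.asymm

lemma sum_lt_perm (σ : Equiv.Perm (Fin n)) (g : Fin n × Fin n → ℝ) (hg : ∀ p, g p.swap = g p) :
    ∑ p with σ p.1 < σ p.2, g p = ∑ p with p.1 < p.2, g p := by
  have h1 := two_mul_sum_lt σ g hg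
  have h2 : 2 * ∑ p with p.1 < p.2, g p = ∑ p with p.1 ≠ p.2, g p := two_mul_sum_lt 1 g hg
  linarith

lemma sum_mul_perm (σ : Equiv.Perm (Fin n)) (c : Fin n → ℝ) :
    ∑ i, c i * ((σ i : ℕ) : ℝ) = ∑ p : Fin n × Fin n with σ p.1 < σ p.2, c p.2 := by
  rw [sum_filter, Fintype.sum_prod_type_right]
  refine sum_congr rfl fun i _ => ?_
  have : #{j | σ j < σ i} = (σ i : ℕ) := by
    rw [← Fin.card_Iio (σ i), ← card_map σ.toEmbedding]
    congr 1
    ext k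
    simp
  rw [← sum_filter]
  dsimp only
  rw [sum_const, this, nsmul_eq_mul, mul_comm]

/-- The edge list of the complete graph on `Fin n`. -/
noncomputable def pairs (n : ℕ) : List (Fin n × Fin n) :=
  ({p | p.1 < p.2} : Finset (Fin n × Fin n)).toList

lemma edgesIn_pairs (A : Finset (Fin n)) :
    ((edgesIn A (pairs n) : ℤ) : ℝ) =
      ∑ p : Fin n × Fin n with p.1 < p.2, if p.1 ∈ A ∧ p.2 ∈ A then 1 else 0 := by
  rw [pairs, edgesIn_toList]
  push_cast
  rfl

lemma edgesIn_le_sum_perm (σ : Equiv.Perm (Fin n)) (A : Finset (Fin n)) :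
    ((edgesIn A (pairs n) : ℤ) : ℝ) ≤ ∑ i ∈ A, ((σ i : ℕ) : ℝ) := by
  have h := sum_mul_perm σ fun i => if i ∈ A then 1 else 0
  simp only [ite_mul, one_mul, zero_mul, sum_ite_mem, univ_inter] at h
  rw [h, edgesIn_pairs, ← sum_lt_perm σ _ (fun p => by simp [and_comm])]
  refine sum_le_sum fun p _ => ?_
  split_ifs <;> simp_all

lemma sum_perm_eq_edgesIn (σ : Equiv.Perm (Fin n)) :
    ∑ i, ((σ i : ℕ) : ℝ) = (edgesIn univ (pairs n) : ℤ) := by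
  have h := sum_mul_perm σ fun _ => 1
  simp only [one_mul] at h
  rw [h, edgesIn_pairs, ← sum_lt_perm σ _ (fun p => by simp)]
  simp

lemma exists_perm_sum_mul_ge (a : Fin n → ℝ) {d : Fin n → ℤ} (hd : d ∈ scores (pairs n)) :
    ∃ σ : Equiv.Perm (Fin n), ∑ i, a i * d i ≤ ∑ i, a i * ((σ i : ℕ) : ℝ) := by
  refine ⟨(Tuple.sort a)⁻¹, (sum_mul_le_of_mem_scores a hd).trans ?_⟩
  rw [pairs, sum_map_toList, sum_mul_perm,
    ← sum_lt_perm (Tuple.sort a)⁻¹ _ (fun p => by simp [max_comm])]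
  refine sum_le_sum fun p hp => max_le ?_ le_rfl
  have := Tuple.monotone_sort a (mem_filter.1 hp).2.le
  simpa using this

/-- The vertex of the permutohedron corresponding to a permutation. -/
def vertex (σ : Equiv.Perm (Fin n)) : Fin n → ℝ := fun i => ((σ i : ℕ) : ℝ) + 1

lemma mem_convexHull_of_mem_scores {d : Fin n → ℤ} (hd : d ∈ scores (pairs n)) :
    (fun i => (d i : ℝ) + 1) ∈ convexHull ℝ (Set.range (vertex (n := n))) := by
  by_contra hcon
  obtain ⟨f, u, h1, h2⟩ := geometric_hahn_banach_closed_point (convex_convexHull ℝ _)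
    ((Set.finite_range (vertex (n := n))).isClosed_convexHull ℝ) hcon
  obtain ⟨σ, hσ⟩ := exists_perm_sum_mul_ge (fun i => f fun j => if i = j then 1 else 0) hd
  have h3 := h1 _ (subset_convexHull ℝ _ ⟨σ, rfl⟩)
  have hf : ∀ x, f x = ∑ i, x i • f fun j => if i = j then 1 else 0 :=
    fun x => LinearMap.pi_apply_eq_sum_univ f.toLinearMap x
  rw [hf] at h2 h3
  simp only [vertex, smul_eq_mul, add_mul, sum_add_distrib] at h2 h3
  simp only [mul_comm (f _)] at hσ
  linarith

lemma landau_of_mem_convexHull {x : Fin n → ℝ}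
    (hx : x ∈ convexHull ℝ (Set.range (vertex (n := n)))) :
    ∑ i, (x i - 1) = (edgesIn univ (pairs n) : ℤ) ∧
      ∀ A, ((edgesIn A (pairs n) : ℤ) : ℝ) ≤ ∑ i ∈ A, (x i - 1) := by
  refine (convexHull_min (t := {x : Fin n → ℝ | ∑ i, (x i - 1) = ((edgesIn univ (pairs n) : ℤ) : ℝ) ∧
      ∀ A, ((edgesIn A (pairs n) : ℤ) : ℝ) ≤ ∑ i ∈ A, (x i - 1)}) ?_ ?_) hx
  · rintro _ ⟨σ, rfl⟩
    simp only [vertex, Set.mem_ofPred_eq, add_sub_cancel_right]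
    exact ⟨sum_perm_eq_edgesIn σ, edgesIn_le_sum_perm σ⟩
  · clear hx x
    intro x hx y hy s t hs ht hst
    have key : ∀ A : Finset (Fin n), ∑ i ∈ A, ((s • x + t • y) i - 1) =
        s * ∑ i ∈ A, (x i - 1) + t * ∑ i ∈ A, (y i - 1) := by
      intro A
      rw [mul_sum, mul_sum, ← sum_add_distrib]
      refine sum_congr rfl fun i _ => ?_
      simp only [Pi.add_apply, Pi.smul_apply, smul_eq_mul]
      linear_combination hst
    refine ⟨?_, fun A => ?_⟩
    · rw [key, hx.1, hy.1, ← add_mul, hst, one_mul]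
    · rw [key]
      calc ((edgesIn A (pairs n) : ℤ) : ℝ)
          = s * (edgesIn A (pairs n) : ℤ) + t * (edgesIn A (pairs n) : ℤ) := by
            rw [← add_mul, hst, one_mul]
        _ ≤ _ := add_le_add (mul_le_mul_of_nonneg_left (hx.2 A) hs)
            (mul_le_mul_of_nonneg_left (hy.2 A) ht)

/-- The integer points of the permutohedron are the shifted score vectors of tournaments. -/
lemma integerPoints_eq_image (n : ℕ) :
    {x : Fin n → ℝ | x ∈ convexHull ℝ (Set.range (vertex (n := n))) ∧
      ∀ i, ∃ m : ℤ, x i = (m : ℝ)} =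
    (fun (d : Fin n → ℤ) i => (d i : ℝ) + 1) '' (scores (pairs n)) := by
  ext x
  constructor
  · rintro ⟨hx, hint⟩
    choose m hm using hint
    obtain rfl : x = fun i => (m i : ℝ) := funext hm
    refine ⟨fun i => m i - 1, ?_, by simp⟩
    rw [mem_coe, mem_scores_iff]
    have := landau_of_mem_convexHull hx
    exact_mod_cast this
  · rintro ⟨d, hd, rfl⟩
    exact ⟨mem_convexHull_of_mem_scores hd, fun i => ⟨d i + 1, by simp⟩⟩

lemma card_scores_pairs (n : ℕ) :
    #(scores (pairs n)) = {G : SimpleGraph (Fin n) | G.IsAcyclic}.ncard := by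
  have h := card_scores_eq_ncard_acyclic (pairs n) ⊥ id SimpleGraph.isAcyclic_bot (by simp) ?_ ?_
  · have htop : listGraph (pairs n) = ⊤ := by
      ext a b
      rw [listGraph_adj, SimpleGraph.top_adj, and_iff_left_iff_imp]
      intro hab
      rcases lt_or_gt_of_ne hab with h | h
      · exact ⟨(a, b), by simpa [pairs] using h, rfl⟩
      · exact ⟨(b, a), by simpa [pairs] using h, Sym2.eq_swap⟩
    simpa [htop] using h
  · refine List.Pairwise.imp_of_mem ?_ (nodup_toList _)
    intro e e' he he' hne h
    simp only [pairs, mem_toList, mem_filter, mem_univ, true_and] at he he'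
    rcases Sym2.eq_iff.1 h with h | h
    · exact hne (Prod.ext h.1 h.2)
    · exact absurd he' (by rw [← h.1, ← h.2]; exact he.asymm)
  · intro e he
    simp only [pairs, mem_toList, mem_filter, mem_univ, true_and] at he
    simpa using he.ne

end Permutohedron

/-- The number of integer points in the permutohedron `P_n` (the convex hull of all
permutations of `(1, 2, ..., n)`) equals the number of forests on `n` labelled
vertices. -/
theorem stmt4 (n : ℕ) :
    Nat.card {x : Fin n → ℝ //
        x ∈ convexHull ℝ
          (Set.range fun σ : Equiv.Perm (Fin n) => fun i : Fin n => ((σ i : ℕ) : ℝ) + 1) ∧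
        ∀ i, ∃ m : ℤ, x i = (m : ℝ)} =
      Nat.card {G : SimpleGraph (Fin n) // G.IsAcyclic} := by
  refine (Nat.card_coe_set_eq _).trans ((congrArg Set.ncard
    (Permutohedron.integerPoints_eq_image n)).trans ?_)
  rw [Set.ncard_image_of_injective, Set.ncard_coe_finset, Permutohedron.card_scores_pairs]
  · exact (Nat.card_coe_set_eq _).symm
  · intro d d' h
    ext i
    simpa using congrFun h i
end

section
/- Fix m ≥ 1 and distinct positive real numbers a_1, ..., a_m. For n ≥ 1 let C_{n-1} be the arrangement in V_{n-1} with hyperplanes x_i − x_j = a_s for all i ≠ j and all 1 ≤ s ≤ m, and let C⁰_{n-1} be the arrangement in V_{n-1} with hyperplanes x_i − x_j = 0 and x_i − x_j = a_s for all i ≠ j and all 1 ≤ s ≤ m; by convention r(C_{-1}) = 1 (the case n = 0). Then for every n ≥ 1, r(C⁰_{n-1}) = Σ_{k=0}^{n} c(n,k)·r(C_{k-1}), where c(n,k) is the signless Stirling number of the first kind, i.e., the number of permutations of {1,...,n} with exactly k cycles. -/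
/-- The number of cycles (including fixed points) of a permutation `σ`, i.e. the number
of orbits of the cyclic group generated by `σ`. -/
noncomputable def cyclesCount {n : ℕ} (σ : Equiv.Perm (Fin n)) : ℕ :=
  Nat.card (MulAction.orbitRel.Quotient (Subgroup.zpowers σ) (Fin n))

theorem card_connectedComponents_eq_card_range {X α : Type*} [TopologicalSpace X] (f : X → α)
    (hf : IsLocallyConstant f) (hc : ∀ c, IsPreconnected (f ⁻¹' {c})) :
    Nat.card (ConnectedComponents X) = Nat.card (Set.range f) := by
  have key (x y : X) : (x : ConnectedComponents X) = y ↔ f x = f y := by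
    rw [ConnectedComponents.coe_eq_coe']
    constructor
    · intro h
      exact hf.apply_eq_of_isPreconnected isPreconnected_connectedComponent h mem_connectedComponent
    · intro h
      exact (hc (f y)).subset_connectedComponent rfl h
  refine Nat.card_eq_of_bijective
    (Quotient.lift (s := connectedComponentSetoid X) (fun x => (⟨f x, x, rfl⟩ : Set.range f))
      fun x y h => Subtype.ext ((key x y).1 (Quotient.sound h))) ⟨?_, ?_⟩
  · rintro ⟨x⟩ ⟨y⟩ h
    exact (key x y).2 (congrArg Subtype.val h)
  · rintro ⟨_, x, rfl⟩
    exact ⟨(x : ConnectedComponents X), rfl⟩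

/-- The points avoiding all hyperplanes `x i - x j = b s` with `i ≠ j`. -/
def avoidingPoints (ι : Type*) {S : Type*} (b : S → ℝ) : Set (ι → ℝ) :=
  {x | ∀ i j, i ≠ j → ∀ s, x i - x j ≠ b s}

/-- The side of each hyperplane `x i - x j = b s` on which `x` lies. -/
def sidePattern {ι S : Type*} (b : S → ℝ) (x : ι → ℝ) : ι → ι → S → Prop :=
  fun i j s => b s < x i - x j

/-- The side patterns of the regions of the arrangement `x i - x j = b s`, `i ≠ j`. -/
def regionPatterns (ι : Type*) {S : Type*} (b : S → ℝ) : Set (ι → ι → S → Prop) :=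
  sidePattern b '' avoidingPoints ι b

theorem sidePattern_eq_iff {ι S : Type*} {b : S → ℝ} {x y : ι → ℝ} :
    sidePattern b x = sidePattern b y ↔ ∀ i j s, b s < x i - x j ↔ b s < y i - y j := by
  simp [funext_iff, sidePattern]

theorem sidePattern_comp {ι κ S : Type*} (b : S → ℝ) (x : κ → ℝ) (f : ι → κ) :
    sidePattern b (x ∘ f) = fun i j => sidePattern b x (f i) (f j) := rfl

theorem comp_mem_avoidingPoints {ι κ S : Type*} {b : S → ℝ} {x : κ → ℝ}
    (hx : x ∈ avoidingPoints κ b) {f : ι → κ} (hf : Function.Injective f) :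
    x ∘ f ∈ avoidingPoints ι b := fun _ _ h => hx _ _ (hf.ne h)

theorem convex_sidePattern_fiber {ι S : Type*} (b : S → ℝ) (p : ι → ι → S → Prop) :
    Convex ℝ {x | x ∈ avoidingPoints ι b ∧ sidePattern b x = p} := by
  rintro x ⟨hx, rfl⟩ y ⟨hy, hxy⟩ u v hu hv huv
  rw [sidePattern_eq_iff] at hxy
  have sides (i j s) (h : i ≠ j) :
      (b s < x i - x j ∧ b s < (u • x + v • y) i - (u • x + v • y) j) ∨
      (x i - x j < b s ∧ (u • x + v • y) i - (u • x + v • y) j < b s) := by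
    have e : (u • x + v • y) i - (u • x + v • y) j = u • (x i - x j) + v • (y i - y j) := by
      simp; ring
    rw [e]
    rcases (hx i j h s).lt_or_gt with h1 | h1
    · have h2 : y i - y j < b s :=
        lt_of_le_of_ne (not_lt.1 fun h3 => h1.not_gt ((hxy i j s).1 h3)) (hy i j h s)
      exact Or.inr ⟨h1, convex_Iio (b s) h1 h2 hu hv huv⟩
    · exact Or.inl ⟨h1, convex_Ioi (b s) h1 ((hxy i j s).2 h1) hu hv huv⟩
  refine ⟨fun i j h s => ?_, sidePattern_eq_iff.2 fun i j s => ?_⟩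
  · rcases sides i j s h with h | h
    exacts [h.2.ne', h.2.ne]
  · rcases eq_or_ne i j with rfl | h
    · simp
    · rcases sides i j s h with h | h
      · exact iff_of_true h.2 h.1
      · exact iff_of_false h.2.not_gt h.1.not_gt

theorem isLocallyConstant_sidePattern {ι S : Type*} [Finite ι] [Finite S] (b : S → ℝ)
    {A : Set (ι → ℝ)} (hA : A ⊆ avoidingPoints ι b) :
    IsLocallyConstant fun x : A => sidePattern b x.1 := by
  rw [IsLocallyConstant.iff_eventually_eq]
  intro x
  have hcont (i j : ι) : Continuous fun y : A => y.1 i - y.1 j :=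
    ((continuous_apply i).comp continuous_subtype_val).sub
      ((continuous_apply j).comp continuous_subtype_val)
  have : ∀ᶠ y : A in nhds x, ∀ i j s, b s < y.1 i - y.1 j ↔ b s < x.1 i - x.1 j := by
    simp only [Filter.eventually_all]
    intro i j s
    rcases eq_or_ne i j with rfl | h
    · simp
    · rcases (hA x.2 i j h s).lt_or_gt with h | h
      · filter_upwards [(hcont i j).continuousAt.eventually_lt_const h] with y hy
        exact iff_of_false hy.not_gt h.not_gt
      · filter_upwards [(hcont i j).continuousAt.eventually_const_lt h] with y hy
        exact iff_of_true hy h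
  filter_upwards [this] with y hy using sidePattern_eq_iff.2 hy

theorem numRegions_eq_card_regionPatterns {ι S : Type*} [Fintype ι] [Finite S] (b : S → ℝ) :
    numRegions {x : ι → ℝ | ∑ i, x i = 0 ∧ ∀ i j, i ≠ j → ∀ s, x i - x j ≠ b s} =
      Nat.card (regionPatterns ι b) := by
  set A := {x : ι → ℝ | ∑ i, x i = 0 ∧ ∀ i j, i ≠ j → ∀ s, x i - x j ≠ b s}
  have hA : A ⊆ avoidingPoints ι b := fun x hx => hx.2
  have hrange : Set.range (fun x : A => sidePattern b x.1) = regionPatterns ι b := by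
    ext p
    constructor
    · rintro ⟨x, rfl⟩
      exact ⟨x, hA x.2, rfl⟩
    · rintro ⟨x, hx, rfl⟩
      refine ⟨⟨fun i => x i - (∑ i, x i) / Fintype.card ι, ?_, ?_⟩, ?_⟩
      · rcases isEmpty_or_nonempty ι with h | h
        · simp
        · simp [mul_div_cancel₀]
      · intro i j h s
        simpa using hx i j h s
      · simp [sidePattern_eq_iff]
  rw [numRegions, card_connectedComponents_eq_card_range _ (isLocallyConstant_sidePattern b hA),
    hrange]
  intro p
  rw [← Topology.IsInducing.subtypeVal.isPreconnected_image]
  have hsum : Convex ℝ {x : ι → ℝ | ∑ i, x i = 0} := by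
    intro x hx y hy u v _ _ _
    simp only [Set.mem_ofPred_eq] at hx hy ⊢
    simp [Finset.sum_add_distrib, ← Finset.mul_sum, hx, hy]
  convert (hsum.inter (convex_sidePattern_fiber b p)).isPreconnected using 1
  ext x
  simp [A, avoidingPoints, and_comm, and_left_comm]

theorem card_regionPatterns_congr {ι κ S : Type*} (e : ι ≃ κ) (b : S → ℝ) :
    Nat.card (regionPatterns ι b) = Nat.card (regionPatterns κ b) := by
  refine Nat.card_congr (((e.arrowCongr (e.arrowCongr (Equiv.refl (S → Prop))))).subtypeEquiv ?_)
  intro p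
  constructor
  · rintro ⟨x, hx, rfl⟩
    exact ⟨x ∘ e.symm, comp_mem_avoidingPoints hx e.symm.injective, rfl⟩
  · rintro ⟨x, hx, h⟩
    refine ⟨x ∘ e, comp_mem_avoidingPoints hx e.injective, ?_⟩
    rw [sidePattern_comp, h]
    ext i j s
    simp

/-- Relabelling of coordinates acts on the regions. -/
instance regionPatternsAction (ι : Type*) {S : Type*} (b : S → ℝ) :
    MulAction (Equiv.Perm ι) (regionPatterns ι b) where
  smul σ p := ⟨fun i j => p.1 (σ⁻¹ i) (σ⁻¹ j), by
    obtain ⟨_, x, hx, rfl⟩ := p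
    exact ⟨x ∘ ⇑σ⁻¹, comp_mem_avoidingPoints hx σ⁻¹.injective, rfl⟩⟩
  one_smul _ := rfl
  mul_smul _ _ _ := rfl

theorem regionPatterns_smul_val {ι S : Type*} {b : S → ℝ} (σ : Equiv.Perm ι)
    (p : regionPatterns ι b) : (σ • p).1 = fun i j => p.1 (σ⁻¹ i) (σ⁻¹ j) := rfl

theorem exists_invariant_of_fixed {ι S : Type*} [Finite ι] {b : S → ℝ} {σ : Equiv.Perm ι}
    {p : regionPatterns ι b} (h : σ • p = p) :
    ∃ x ∈ avoidingPoints ι b, sidePattern b x = p.1 ∧ x ∘ σ = x := by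
  obtain ⟨x, hx, hxp⟩ := p.2
  have hk (k : ℕ) : x ∘ ⇑(σ ^ k) ∈ {x | x ∈ avoidingPoints ι b ∧ sidePattern b x = p.1} := by
    refine ⟨comp_mem_avoidingPoints hx (σ ^ k).injective, ?_⟩
    have h1 : (σ ^ k)⁻¹ • p = p := inv_smul_eq_iff.2 <| by
      induction k with
      | zero => simp
      | succ k ih => rw [pow_succ, mul_smul, h, ← ih]
    rw [sidePattern_comp, hxp]
    conv_rhs => rw [← h1, regionPatterns_smul_val, inv_inv]
  have hN : 0 < orderOf σ := orderOf_pos σ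
  have hN' : (orderOf σ : ℝ) ≠ 0 := by positivity
  set y : ι → ℝ := ∑ k ∈ Finset.range (orderOf σ), (orderOf σ : ℝ)⁻¹ • (x ∘ ⇑(σ ^ k)) with hy
  have hmem := (convex_sidePattern_fiber b p.1).sum_mem (t := Finset.range (orderOf σ))
    (w := fun _ => (orderOf σ : ℝ)⁻¹) (z := fun k => x ∘ ⇑(σ ^ k))
    (fun _ _ => by positivity) (by simp [hN']) (fun k _ => hk k)
  refine ⟨y, hmem.1, hmem.2, ?_⟩
  ext i
  have e := Finset.sum_range_succ (fun k => (orderOf σ : ℝ)⁻¹ * x ((σ ^ k) i)) (orderOf σ)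
  rw [Finset.sum_range_succ', pow_orderOf_eq_one, pow_zero, add_left_inj] at e
  simpa [hy, pow_succ] using e

theorem card_fixedBy_regionPatterns {ι S : Type*} [Finite ι] {b : S → ℝ} (hb : ∀ s, b s ≠ 0)
    (σ : Equiv.Perm ι) :
    Nat.card (MulAction.fixedBy (regionPatterns ι b) σ) =
      Nat.card (regionPatterns (MulAction.orbitRel.Quotient (Subgroup.zpowers σ) ι) b) := by
  set Q := MulAction.orbitRel.Quotient (Subgroup.zpowers σ) ι
  let π : ι → Q := fun i => Quotient.mk _ i
  have hπ : Function.Surjective π := Quotient.mk_surjective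
  have hσ (i : ι) : π (σ i) = π i :=
    Quotient.sound ⟨⟨σ, Subgroup.mem_zpowers σ⟩, rfl⟩
  have hσ' (i : ι) : π (σ⁻¹ i) = π i := by
    rw [← hσ]; simp
  symm
  refine Nat.card_eq_of_bijective (fun p => ⟨⟨fun i j => p.1 (π i) (π j), ?_⟩, ?_⟩) ⟨?_, ?_⟩
  · obtain ⟨_, z, hz, rfl⟩ := p
    refine ⟨z ∘ π, fun i j _ s => ?_, rfl⟩
    rcases eq_or_ne (π i) (π j) with h | h
    · simpa [h] using (hb s).symm
    · exact hz _ _ h s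
  · refine Subtype.ext ?_
    rw [regionPatterns_smul_val]
    simp only [hσ']
  · intro p q h
    refine Subtype.ext ?_
    ext u v s
    obtain ⟨i, rfl⟩ := hπ u
    obtain ⟨j, rfl⟩ := hπ v
    exact iff_of_eq (congrFun (congrFun (congrFun (congrArg (fun r => r.1.1) h) i) j) s)
  · rintro ⟨p, hp⟩
    obtain ⟨x, hx, hxp, hinv⟩ := exists_invariant_of_fixed hp
    have hlift (i j : ι) (h : (MulAction.orbitRel (Subgroup.zpowers σ) ι) i j) : x i = x j := by
      obtain ⟨⟨_, k, rfl⟩, rfl⟩ := h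
      have hinv' : ∀ i, x (σ i) = x i := congrFun hinv
      change x ((σ ^ k) j) = x j
      induction k using Int.induction_on generalizing j with
      | zero => simp
      | succ k ih => rw [zpow_add_one, Equiv.Perm.mul_apply, ih, hinv']
      | pred k ih =>
        rw [zpow_sub_one, Equiv.Perm.mul_apply, ih]
        exact (hinv' _).symm.trans (congrArg x (σ.apply_symm_apply j))
    let z : Q → ℝ := Quotient.lift x hlift
    refine ⟨⟨sidePattern b z, z, ?_, rfl⟩, ?_⟩
    · intro u v h s
      obtain ⟨i, rfl⟩ := hπ u
      obtain ⟨j, rfl⟩ := hπ v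
      exact hx i j (fun e => h (e ▸ rfl)) s
    · exact Subtype.ext (Subtype.ext hxp)

/-- The side patterns of the regions that contain a weakly increasing point. -/
def monotonePatterns (n : ℕ) {S : Type*} (b : S → ℝ) : Set (Fin n → Fin n → S → Prop) :=
  sidePattern b '' {x | x ∈ avoidingPoints (Fin n) b ∧ Monotone x}

theorem sidePattern_eq_of_monotone {n : ℕ} {S : Type*} {b : S → ℝ} {x y : Fin n → ℝ}
    (hx : Monotone x) (hy : Monotone y) {σ : Equiv.Perm (Fin n)}
    (h : sidePattern b x = sidePattern b (y ∘ σ)) : sidePattern b x = sidePattern b y := by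
  classical
  rw [sidePattern_eq_iff] at h ⊢
  intro i j s
  let below (z : Fin n → ℝ) (i : Fin n) : Finset (Fin n) := {j | b s < z i - z j}
  have hmono {z : Fin n → ℝ} (hz : Monotone z) : Monotone fun i => (below z i).card := by
    intro i i' hi
    refine Finset.card_le_card fun j hj => ?_
    simp only [below, Finset.mem_filter, Finset.mem_univ, true_and] at hj ⊢
    linarith [hz hi]
  have hlower {z : Fin n → ℝ} (hz : Monotone z) (i : Fin n) :
      IsLowerSet (below z i : Set (Fin n)) := by
    intro j j' hj hmem
    simp only [below, Finset.coe_filter, Finset.mem_univ, true_and, Set.mem_ofPred_eq] at hmem ⊢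
    linarith [hz hj]
  have hcard : (fun i => (below x i).card) = (fun i => (below y i).card) ∘ σ := by
    ext i
    refine Finset.card_bij (fun j _ => σ j) ?_ (fun _ _ _ _ e => σ.injective e) ?_
    · intro j hj
      simpa [below] using (h i j s).1 (by simpa [below] using hj)
    · intro j hj
      have := h i (σ.symm j) s
      simp only [Function.comp_apply, Equiv.apply_symm_apply] at this
      exact ⟨σ.symm j, by simpa [below, this] using hj, σ.apply_symm_apply j⟩
  have heq : (fun i => (below x i).card) = fun i => (below y i).card := by
    rw [hcard]
    exact Tuple.unique_monotone (τ := 1) (hcard ▸ hmono hx) (hmono hy)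
  have hset : below x i = below y i := by
    have hi := congrFun heq i
    rcases (hlower hx i).total (hlower hy i) with hsub | hsub
    · exact Finset.eq_of_subset_of_card_le (Finset.coe_subset.1 hsub) hi.ge
    · exact (Finset.eq_of_subset_of_card_le (Finset.coe_subset.1 hsub) hi.le).symm
  simpa [below] using Finset.ext_iff.1 hset j

theorem card_orbits_regionPatterns (n : ℕ) {S : Type*} (b : S → ℝ) :
    Nat.card (Quotient (MulAction.orbitRel (Equiv.Perm (Fin n)) (regionPatterns (Fin n) b))) =
      Nat.card (monotonePatterns n b) := by
  symm
  refine Nat.card_eq_of_bijective (fun p => Quotient.mk _ ⟨p.1, ?_⟩) ⟨?_, ?_⟩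
  · obtain ⟨_, x, hx, rfl⟩ := p
    exact ⟨x, hx.1, rfl⟩
  · rintro ⟨_, x, hx, rfl⟩ ⟨_, y, hy, rfl⟩ h
    obtain ⟨σ, hσ⟩ := Quotient.exact h
    refine Subtype.ext (sidePattern_eq_of_monotone hx.2 hy.2 (σ := σ⁻¹) ?_)
    exact (congrArg Subtype.val hσ).symm
  · rintro ⟨_, x, hx, rfl⟩
    refine ⟨⟨sidePattern b (x ∘ Tuple.sort x), _,
      ⟨comp_mem_avoidingPoints hx (Tuple.sort x).injective, Tuple.monotone_sort x⟩, rfl⟩, ?_⟩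
    refine Quotient.sound ⟨(Tuple.sort x)⁻¹, Subtype.ext ?_⟩
    rw [regionPatterns_smul_val]
    simp [sidePattern_comp]

theorem exists_strictMono_sidePattern_eq {n : ℕ} {S : Type*} [Finite S] {b : S → ℝ}
    {x : Fin n → ℝ} (hx : x ∈ avoidingPoints (Fin n) b) (hmono : Monotone x) :
    ∃ y ∈ avoidingPoints (Fin n) b, StrictMono y ∧ sidePattern b y = sidePattern b x := by
  let y (ε : ℝ) (i : Fin n) : ℝ := x i + ε * (i : ℝ)
  have hcont (i j : Fin n) : Continuous fun ε => y ε i - y ε j := by fun_prop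
  have h0 (i : Fin n) : y 0 i = x i := by simp [y]
  have hev : ∀ᶠ ε in nhds (0 : ℝ), ∀ i j s,
      (i ≠ j → y ε i - y ε j ≠ b s) ∧ (b s < y ε i - y ε j ↔ b s < x i - x j) := by
    simp only [Filter.eventually_all]
    intro i j s
    rcases eq_or_ne i j with rfl | h
    · simp
    · rcases (hx i j h s).lt_or_gt with h | h
      · filter_upwards [(hcont i j).continuousAt.eventually_lt_const
          (by simpa only [h0] using h)] with ε hε
        exact ⟨fun _ => hε.ne, iff_of_false hε.not_gt h.not_gt⟩
      · filter_upwards [(hcont i j).continuousAt.eventually_const_lt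
          (by simpa only [h0] using h)] with ε hε
        exact ⟨fun _ => hε.ne', iff_of_true hε h⟩
  obtain ⟨ε, hε, hpos⟩ := ((hev.filter_mono nhdsWithin_le_nhds).and
    (self_mem_nhdsWithin : Set.Ioi (0 : ℝ) ∈ nhdsWithin 0 (Set.Ioi 0))).exists
  refine ⟨y ε, fun i j h s => (hε i j s).1 h, fun i j h => ?_,
    sidePattern_eq_iff.2 fun i j s => (hε i j s).2⟩
  have hij : (i : ℝ) < (j : ℝ) := by exact_mod_cast h
  exact add_lt_add_of_le_of_lt (hmono h.le) (mul_lt_mul_of_pos_left hij hpos)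

theorem card_regionPatterns_option (n : ℕ) {S : Type*} [Finite S] (b : S → ℝ) :
    Nat.card (regionPatterns (Fin n) fun o : Option S => o.elim 0 b) =
      Nat.card (monotonePatterns n b) * n.factorial := by
  let F (q : monotonePatterns n b × Equiv.Perm (Fin n)) :
      Fin n → Fin n → Option S → Prop :=
    fun i j o => o.elim (q.2 j < q.2 i) fun s => q.1.1 (q.2 i) (q.2 j) s
  have hF {x : Fin n → ℝ} (hx : StrictMono x) (p : monotonePatterns n b)
      (hp : sidePattern b x = p.1) (σ : Equiv.Perm (Fin n)) :
      sidePattern (fun o : Option S => o.elim 0 b) (x ∘ σ) = F (p, σ) := by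
    ext i j o
    cases o with
    | none => simp [sidePattern, F, hx.lt_iff_lt]
    | some s => simp [F, ← hp, sidePattern]
  have hinj : Function.Injective F := by
    rintro ⟨p, σ⟩ ⟨q, τ⟩ h
    have hlt (i j : Fin n) : σ j < σ i ↔ τ j < τ i :=
      iff_of_eq (congrFun (congrFun (congrFun h i) j) none)
    have hστ : σ = τ := by
      have hmono : StrictMono (τ ∘ ⇑σ⁻¹) := fun i j hij => by
        simpa using (hlt (σ⁻¹ j) (σ⁻¹ i)).1 (by simpa using hij)
      have := Tuple.unique_monotone (f := id) (σ := τ * σ⁻¹) (τ := 1)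
        (by simpa using hmono.monotone) (by simpa using monotone_id)
      ext i
      simpa using congrArg Fin.val (congrFun this (σ i)).symm
    subst hστ
    refine Prod.ext (Subtype.ext ?_) rfl
    ext i j s
    simpa [F] using congrFun (congrFun (congrFun h (σ⁻¹ i)) (σ⁻¹ j)) (some s)
  have hrange : Set.range F = regionPatterns (Fin n) fun o : Option S => o.elim 0 b := by
    ext p
    constructor
    · rintro ⟨⟨⟨p, x, hx, hxp⟩, σ⟩, rfl⟩
      obtain ⟨y, hy, hymono, hyx⟩ := exists_strictMono_sidePattern_eq hx.1 hx.2
      refine ⟨y ∘ σ, ?_, hF hymono _ (hyx.trans hxp) σ⟩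
      rintro i j h (_ | s)
      · exact sub_ne_zero.2 (hymono.injective.ne (σ.injective.ne h))
      · exact hy _ _ (σ.injective.ne h) s
    · rintro ⟨x, hx, rfl⟩
      have hxinj : Function.Injective x := fun i j h => by
        by_contra hij
        exact hx i j hij none (sub_eq_zero.2 h)
      have hxb : x ∈ avoidingPoints (Fin n) b := fun i j h s => hx i j h (some s)
      have hsort := (Tuple.monotone_sort x).strictMono_of_injective
        (hxinj.comp (Tuple.sort x).injective)
      refine ⟨(⟨_, x ∘ Tuple.sort x, ⟨comp_mem_avoidingPoints hxb (Tuple.sort x).injective,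
        hsort.monotone⟩, rfl⟩, (Tuple.sort x)⁻¹), ?_⟩
      rw [← hF hsort _ rfl]
      congr 1
      ext i
      simp
  rw [← hrange, ← Nat.card_congr (Equiv.ofInjective F hinj), Nat.card_prod, Nat.card_perm,
    Nat.card_fin]

theorem cyclesCount_le {n : ℕ} (σ : Equiv.Perm (Fin n)) : cyclesCount σ ≤ n := by
  simpa [cyclesCount] using Nat.card_le_card_of_surjective
    (Quotient.mk (MulAction.orbitRel (Subgroup.zpowers σ) (Fin n))) Quotient.mk_surjective

theorem sum_perm_eq_sum_cyclesCount (n : ℕ) (f : ℕ → ℕ) :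
    ∑ σ : Equiv.Perm (Fin n), f (cyclesCount σ) =
      ∑ k ∈ Finset.range (n + 1),
        Nat.card {σ : Equiv.Perm (Fin n) // cyclesCount σ = k} * f k := by
  classical
  rw [← Finset.sum_fiberwise_of_maps_to (t := Finset.range (n + 1)) (g := cyclesCount)
    fun σ _ => Finset.mem_range_succ_iff.2 (cyclesCount_le σ)]
  refine Finset.sum_congr rfl fun k _ => ?_
  rw [Finset.sum_congr rfl fun σ hσ => by rw [(Finset.mem_filter.1 hσ).2], Finset.sum_const,
    smul_eq_mul, Nat.card_eq_fintype_card, Fintype.card_subtype]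

theorem sum_card_fixedBy_regionPatterns (n : ℕ) {S : Type*} [Finite S] (b : S → ℝ) :
    ∑ σ : Equiv.Perm (Fin n), Nat.card (MulAction.fixedBy (regionPatterns (Fin n) b) σ) =
      Nat.card (monotonePatterns n b) * n.factorial := by
  classical
  have := Fintype.ofFinite (regionPatterns (Fin n) b)
  have := Fintype.ofFinite
    (Quotient (MulAction.orbitRel (Equiv.Perm (Fin n)) (regionPatterns (Fin n) b)))
  have h := MulAction.sum_card_fixedBy_eq_card_orbits_mul_card_group (Equiv.Perm (Fin n))
    (regionPatterns (Fin n) b)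
  rw [Fintype.card_perm, Fintype.card_fin, ← Nat.card_eq_fintype_card,
    card_orbits_regionPatterns] at h
  simpa only [Nat.card_eq_fintype_card] using h

/-- For the Catalan-type arrangements `C_{n-1} : x_i - x_j = a_s` (`i ≠ j`) and
`C⁰_{n-1} : x_i - x_j = 0, a_s` (`i ≠ j`) in `V_{n-1}`, with `a_1, ..., a_m` distinct
positive reals, one has `r(C⁰_{n-1}) = ∑_k c(n,k) r(C_{k-1})`, where `c(n,k)` is the
signless Stirling number of the first kind. -/
theorem stmt6 (m : ℕ) (hm : 1 ≤ m) (a : Fin m → ℝ) (hpos : ∀ s, 0 < a s)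
    (hdist : Function.Injective a) (n : ℕ) (hn : 1 ≤ n) :
    numRegions {x : Fin n → ℝ | (∑ i, x i) = 0 ∧
        ∀ i j : Fin n, i ≠ j → (x i - x j ≠ 0 ∧ ∀ s, x i - x j ≠ a s)} =
      ∑ k ∈ Finset.range (n + 1),
        Nat.card {σ : Equiv.Perm (Fin n) // cyclesCount σ = k} *
          numRegions {x : Fin k → ℝ | (∑ i, x i) = 0 ∧
            ∀ i j : Fin k, i ≠ j → ∀ s, x i - x j ≠ a s} := by
  have hzero : {x : Fin n → ℝ | (∑ i, x i) = 0 ∧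
      ∀ i j : Fin n, i ≠ j → (x i - x j ≠ 0 ∧ ∀ s, x i - x j ≠ a s)} =
      {x : Fin n → ℝ | (∑ i, x i) = 0 ∧
        ∀ i j : Fin n, i ≠ j → ∀ o : Option (Fin m), x i - x j ≠ o.elim 0 a} := by
    simp [Option.forall]
  rw [hzero, numRegions_eq_card_regionPatterns fun o : Option (Fin m) => o.elim 0 a,
    card_regionPatterns_option, ← sum_card_fixedBy_regionPatterns]
  simp only [numRegions_eq_card_regionPatterns]
  rw [← sum_perm_eq_sum_cyclesCount n fun k => Nat.card (regionPatterns (Fin k) a)]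
  refine Finset.sum_congr rfl fun σ _ => ?_
  rw [card_fixedBy_regionPatterns fun s => (hpos s).ne']
  exact card_regionPatterns_congr (Finite.equivFin _) a
end

section
/- For n ≥ 1, the number of regions of the arrangement in V_{n-1} consisting of the hyperplanes x_i − x_j = −1, x_i − x_j = 0, and x_i − x_j = 1 for 1 ≤ i < j ≤ n equals n!·C_n, where C_n = (1/(n+1))·binomial(2n, n) is the n-th Catalan number. -/
/-- A space partitioned into nonempty, open, preconnected sets indexed by `T` has as many
connected components as `T` has elements. -/
theorem card_connectedComponents_eq_of_partition {X T : Type*} [TopologicalSpace X]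
    (U : T → Set X) (hopen : ∀ t, IsOpen (U t)) (hconn : ∀ t, IsPreconnected (U t))
    (hne : ∀ t, (U t).Nonempty) (hcover : ∀ x, ∃ t, x ∈ U t)
    (hunique : ∀ x t t', x ∈ U t → x ∈ U t' → t = t') :
    Nat.card (ConnectedComponents X) = Nat.card T := by
  let _ : TopologicalSpace T := ⊥
  have : DiscreteTopology T := ⟨rfl⟩
  choose f hf using hcover
  have hpre : ∀ t, f ⁻¹' {t} = U t := by
    intro t
    ext x
    constructor
    · rintro rfl
      exact hf x
    · exact fun hx => hunique x _ _ (hf x) hx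
  have hcont : Continuous f := continuous_discrete_rng.2 fun t => by
    rw [hpre]
    exact hopen t
  refine Nat.card_eq_of_bijective hcont.connectedComponentsLift ⟨?_, ?_⟩
  · intro a b hab
    obtain ⟨x, rfl⟩ := ConnectedComponents.surjective_coe a
    obtain ⟨y, rfl⟩ := ConnectedComponents.surjective_coe b
    simp only [Continuous.connectedComponentsLift_apply_coe] at hab
    rw [ConnectedComponents.coe_eq_coe]
    have hy : y ∈ U (f x) := by
      rw [hab]
      exact hf y
    exact connectedComponent_eq ((hconn (f x)).subset_connectedComponent (hf x) hy)
  · intro t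
    obtain ⟨x, hx⟩ := hne t
    exact ⟨(x : ConnectedComponents X), hunique x _ _ (hf x) hx⟩

/-- Weakly increasing sequences of length `n` that stay weakly below the diagonal and are
bounded by `k`. -/
def ballotSeq (n k : ℕ) : Set (Fin n → ℕ) :=
  {g | Monotone g ∧ (∀ j, g j ≤ j) ∧ ∀ j, g j ≤ k}

theorem ballotSeq_finite (n k : ℕ) : (ballotSeq n k).Finite :=
  (Set.finite_Iic (fun j : Fin n => (j : ℕ))).subset fun _ hg => hg.2.1

theorem ballotSeq_succ_succ {n k : ℕ} (hk : k + 1 ≤ n) :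
    ballotSeq (n + 1) (k + 1) = ballotSeq (n + 1) k ∪
      (fun g : Fin n → ℕ => (Fin.snoc g (k + 1) : Fin (n + 1) → ℕ)) '' ballotSeq n (k + 1) := by
  ext g
  constructor
  · rintro ⟨hm, hd, hb⟩
    by_cases hl : g (Fin.last n) ≤ k
    · exact Or.inl ⟨hm, hd, fun j => (hm (Fin.le_last j)).trans hl⟩
    · have hl' : g (Fin.last n) = k + 1 := le_antisymm (hb _) (by omega)
      refine Or.inr ⟨Fin.init g, ⟨?_, ?_, ?_⟩, ?_⟩
      · intro i j hij
        exact hm (Fin.castSucc_le_castSucc_iff.2 hij)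
      · exact fun j => hd j.castSucc
      · exact fun j => hb j.castSucc
      · simp only [← hl', Fin.snoc_init_self]
  · rintro (⟨hm, hd, hb⟩ | ⟨g, ⟨hm, hd, hb⟩, rfl⟩)
    · exact ⟨hm, hd, fun j => (hb j).trans (Nat.le_succ k)⟩
    · refine ⟨?_, ?_, ?_⟩
      · intro i j hij
        induction j using Fin.lastCases with
        | last =>
          induction i using Fin.lastCases with
          | last => exact le_rfl
          | cast i => simpa using hb i
        | cast j =>
          induction i using Fin.lastCases with
          | last => exact absurd hij (not_le.2 (Fin.castSucc_lt_last j))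
          | cast i => simpa using hm (Fin.castSucc_le_castSucc_iff.1 hij)
      · intro j
        induction j using Fin.lastCases with
        | last => simpa using hk
        | cast j => simpa using hd j
      · intro j
        induction j using Fin.lastCases with
        | last => simp
        | cast j => simpa using hb j

theorem ncard_ballotSeq_succ_succ {n k : ℕ} (hk : k + 1 ≤ n) :
    (ballotSeq (n + 1) (k + 1)).ncard =
      (ballotSeq (n + 1) k).ncard + (ballotSeq n (k + 1)).ncard := by
  rw [ballotSeq_succ_succ hk, Set.ncard_union_eq _ (ballotSeq_finite _ _)
    ((ballotSeq_finite _ _).image _), Set.ncard_image_of_injective]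
  · intro g g' h
    simpa using congrArg Fin.init h
  · rw [Set.disjoint_left]
    rintro _ ⟨-, -, hb⟩ ⟨g, -, rfl⟩
    have := hb (Fin.last n)
    simp at this

theorem ncard_ballotSeq_zero (n : ℕ) : (ballotSeq n 0).ncard = 1 := by
  rw [Set.ncard_eq_one]
  refine ⟨fun _ => 0, ?_⟩
  ext g
  constructor
  · rintro ⟨-, -, hb⟩
    ext j
    exact Nat.le_zero.1 (hb j)
  · rintro rfl
    exact ⟨fun _ _ _ => le_rfl, fun _ => Nat.zero_le _, fun _ => le_rfl⟩

theorem ballotSeq_succ_self (n : ℕ) : ballotSeq (n + 1) (n + 1) = ballotSeq (n + 1) n := by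
  ext g
  constructor
  · rintro ⟨hm, hd, -⟩
    exact ⟨hm, hd, fun j => (hd j).trans (Nat.lt_succ_iff.1 j.2)⟩
  · rintro ⟨hm, hd, hb⟩
    exact ⟨hm, hd, fun j => (hb j).trans (Nat.le_succ n)⟩

/-- The ballot formula. -/
theorem ncard_ballotSeq_add_choose (n k : ℕ) (hk : k + 1 ≤ n) :
    (ballotSeq n (k + 1)).ncard + (n + k + 1).choose k = (n + k + 1).choose (k + 1) := by
  induction n generalizing k with
  | zero => omega
  | succ n ihn =>
    induction k with
    | zero =>
      rcases n with _ | n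
      · rw [ballotSeq_succ_self, ncard_ballotSeq_zero]
        rfl
      · have h := ihn 0 (by omega)
        rw [ncard_ballotSeq_succ_succ (by omega), ncard_ballotSeq_zero]
        simp at h ⊢
        omega
    | succ k ihk =>
      have h1 := ihk (by omega)
      have e1 : (n + 1 + (k + 1) + 1).choose (k + 1) =
          (n + 1 + k + 1).choose k + (n + 1 + k + 1).choose (k + 1) := Nat.choose_succ_succ _ _
      have e2 : (n + 1 + (k + 1) + 1).choose (k + 1 + 1) =
          (n + 1 + k + 1).choose (k + 1) + (n + 1 + k + 1).choose (k + 1 + 1) :=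
        Nat.choose_succ_succ _ _
      rcases Nat.lt_or_ge n (k + 1 + 1) with hlt | hge
      · obtain rfl : n = k + 1 := by omega
        rw [ballotSeq_succ_self, e1, e2]
        have := Nat.choose_symm_of_eq_add (n := k + 1 + 1 + k + 1) (a := k + 1) (b := k + 1 + 1)
          (by omega)
        omega
      · have h2 := ihn (k + 1) hge
        rw [ncard_ballotSeq_succ_succ hge, e1, e2]
        rw [show n + (k + 1) + 1 = n + 1 + k + 1 by omega] at h2
        omega

theorem ncard_ballotSeq_self (n : ℕ) : (ballotSeq n n).ncard = catalan n := by
  rcases n with _ | n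
  · rw [ncard_ballotSeq_zero, catalan_zero]
  · have h1 := ncard_ballotSeq_add_choose (n + 1) n le_rfl
    have h2 := succ_mul_catalan_eq_centralBinom (n + 1)
    rw [Nat.centralBinom_eq_two_mul_choose] at h2
    have h3 := Nat.choose_succ_right_eq (2 * (n + 1)) n
    rw [show n + 1 + n + 1 = 2 * (n + 1) by omega] at h1
    rw [show 2 * (n + 1) - n = n + 2 by omega] at h3
    refine Nat.eq_of_mul_eq_mul_left (Nat.succ_pos (n + 1)) ?_
    rw [Nat.succ_eq_add_one, h2]
    nlinarith

/-- A downward closed predicate on `Fin n` is an initial segment. -/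
theorem Fin.exists_iff_val_lt_of_antitone {n : ℕ} (P : Fin n → Prop)
    (hP : ∀ i j, i ≤ j → P j → P i) : ∃ k : ℕ, k ≤ n ∧ ∀ i : Fin n, P i ↔ (i : ℕ) < k := by
  classical
  have hex : ∃ k : ℕ, ∀ i : Fin n, P i → (i : ℕ) < k := ⟨n, fun i _ => i.2⟩
  refine ⟨Nat.find hex, Nat.find_min' hex fun i _ => i.2,
    fun i => ⟨Nat.find_spec hex i, fun hi => ?_⟩⟩
  by_contra hPi
  exact Nat.find_min hex hi fun j hj => by
    by_contra hij
    exact hPi (hP i j (not_lt.1 hij) hj)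

/-- The points whose coordinates are increasingly ordered by `σ`, and for which the coordinates
smaller by more than `1` than the `j`-th smallest are precisely the `g j` smallest ones. -/
def catalanRegion {n : ℕ} (σ : Equiv.Perm (Fin n)) (g : Fin n → ℕ) : Set (Fin n → ℝ) :=
  {x | ∀ i j, i < j → x (σ i) < x (σ j) ∧
    ((i : ℕ) < g j → x (σ i) + 1 < x (σ j)) ∧ (g j ≤ i → x (σ j) < x (σ i) + 1)}

theorem isOpen_catalanRegion {n : ℕ} (σ : Equiv.Perm (Fin n)) (g : Fin n → ℕ) :
    IsOpen (catalanRegion σ g) := by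
  simp only [catalanRegion, Set.ofPred_forall, Set.ofPred_and]
  refine isOpen_iInter_of_finite fun i => isOpen_iInter_of_finite fun j =>
    isOpen_iInter_of_finite fun _ => IsOpen.inter ?_ (IsOpen.inter ?_ ?_)
  · exact isOpen_lt (by fun_prop) (by fun_prop)
  · exact isOpen_iInter_of_finite fun _ => isOpen_lt (by fun_prop) (by fun_prop)
  · exact isOpen_iInter_of_finite fun _ => isOpen_lt (by fun_prop) (by fun_prop)

theorem convex_catalanRegion {n : ℕ} (σ : Equiv.Perm (Fin n)) (g : Fin n → ℕ) :
    Convex ℝ (catalanRegion σ g) := by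
  have key : ∀ {u v u' v' a b c : ℝ}, 0 ≤ a → 0 ≤ b → a + b = 1 → u + c < v → u' + c < v' →
      a * u + b * u' + c < a * v + b * v' := by
    intro u v u' v' a b c ha hb hab h h'
    obtain rfl : b = 1 - a := by linarith
    rcases ha.eq_or_lt with rfl | ha
    · linarith
    · nlinarith [mul_lt_mul_of_pos_left h ha, mul_le_mul_of_nonneg_left h'.le hb]
  intro x hx y hy a b ha hb hab i j hij
  obtain ⟨h1, h2, h3⟩ := hx i j hij
  obtain ⟨h1', h2', h3'⟩ := hy i j hij
  simp only [Pi.add_apply, Pi.smul_apply, smul_eq_mul]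
  refine ⟨?_, fun h => key ha hb hab (h2 h) (h2' h), fun h => ?_⟩
  · simpa using key (c := 0) ha hb hab (by simpa using h1) (by simpa using h1')
  · have e := key (c := -1) ha hb hab (show x (σ j) + -1 < x (σ i) by linarith [h3 h])
      (show y (σ j) + -1 < y (σ i) by linarith [h3' h])
    linarith

theorem sub_ne_of_mem_catalanRegion {n : ℕ} {σ : Equiv.Perm (Fin n)} {g : Fin n → ℕ}
    {x : Fin n → ℝ} (hx : x ∈ catalanRegion σ g) {i j : Fin n} (hij : i ≠ j) :
    x i - x j ≠ -1 ∧ x i - x j ≠ 0 ∧ x i - x j ≠ 1 := by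
  have key : ∀ a b, a < b → x (σ a) < x (σ b) ∧ x (σ b) ≠ x (σ a) + 1 := by
    intro a b hab
    obtain ⟨h1, h2, h3⟩ := hx a b hab
    refine ⟨h1, ?_⟩
    rcases lt_or_ge (a : ℕ) (g b) with h | h
    · exact (h2 h).ne'
    · exact (h3 h).ne
  obtain ⟨a, rfl⟩ := σ.surjective i
  obtain ⟨b, rfl⟩ := σ.surjective j
  rcases lt_or_gt_of_ne (fun h : a = b => hij (congrArg σ h)) with h | h
  · obtain ⟨h1, h2⟩ := key a b h
    exact ⟨fun e => h2 (by linarith), fun e => by linarith, fun e => by linarith⟩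
  · obtain ⟨h1, h2⟩ := key b a h
    exact ⟨fun e => by linarith, fun e => by linarith, fun e => h2 (by linarith)⟩

theorem exists_mem_catalanRegion {n : ℕ} {x : Fin n → ℝ}
    (hx : ∀ i j, i < j → x i - x j ≠ -1 ∧ x i - x j ≠ 0 ∧ x i - x j ≠ 1) :
    ∃ σ, ∃ g ∈ ballotSeq n n, x ∈ catalanRegion σ g := by
  have hx' : ∀ i j, i ≠ j → x i ≠ x j ∧ x j ≠ x i + 1 := by
    intro i j hij
    rcases lt_or_gt_of_ne hij with h | h
    · obtain ⟨h1, h2, h3⟩ := hx i j h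
      exact ⟨fun e => h2 (by linarith), fun e => h1 (by linarith)⟩
    · obtain ⟨h1, h2, h3⟩ := hx j i h
      exact ⟨fun e => h2 (by linarith), fun e => h3 (by linarith)⟩
  have hinj : Function.Injective x := fun i j hij => by
    by_contra h
    exact (hx' i j h).1 hij
  obtain ⟨σ, hσ⟩ : ∃ σ : Equiv.Perm (Fin n), StrictMono (x ∘ σ) :=
    ⟨Tuple.sort x, (Tuple.monotone_sort x).strictMono_of_injective
      (hinj.comp (Equiv.injective _))⟩
  have hseg : ∀ j, ∃ k : ℕ, k ≤ n ∧ ∀ i : Fin n, x (σ i) + 1 < x (σ j) ↔ (i : ℕ) < k :=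
    fun j => Fin.exists_iff_val_lt_of_antitone _ fun i i' hi h => by
      have := hσ.monotone hi
      simp only [Function.comp_apply] at this
      linarith
  choose g hgn hg using hseg
  refine ⟨σ, g, ⟨?_, ?_, hgn⟩, ?_⟩
  · intro j j' hj
    by_contra! h
    have h1 := (hg j ⟨g j', h.trans_le (hgn j)⟩).2 h
    have h2 := hσ.monotone hj
    simp only [Function.comp_apply] at h2
    exact lt_irrefl _ ((hg j' ⟨g j', h.trans_le (hgn j)⟩).1 (h1.trans_le h2))
  · intro j
    by_contra! h
    have := (hg j j).2 h
    linarith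
  · intro i j hij
    refine ⟨hσ hij, (hg j i).2, fun h => ?_⟩
    have h1 := mt (hg j i).1 (not_lt.2 h)
    exact lt_of_le_of_ne (not_lt.1 h1) (hx' _ _ fun e => hij.ne (σ.injective e)).2

theorem catalanRegion_unique {n : ℕ} {σ σ' : Equiv.Perm (Fin n)} {g g' : Fin n → ℕ}
    (hg : ∀ j, g j ≤ j) (hg' : ∀ j, g' j ≤ j) {x : Fin n → ℝ} (hx : x ∈ catalanRegion σ g)
    (hx' : x ∈ catalanRegion σ' g') : σ = σ' ∧ g = g' := by
  have hσ : StrictMono (x ∘ σ) := fun i j hij => (hx i j hij).1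
  have hσ' : StrictMono (x ∘ σ') := fun i j hij => (hx' i j hij).1
  have hinj : Function.Injective x := fun i j hij =>
    σ.symm.injective (hσ.injective (by simpa using hij))
  obtain rfl : σ = σ' := Equiv.ext fun i =>
    hinj (congrFun (Tuple.unique_monotone hσ.monotone hσ'.monotone) i)
  refine ⟨rfl, funext fun j => ?_⟩
  have key : ∀ {g g' : Fin n → ℕ}, (∀ j, g' j ≤ j) → x ∈ catalanRegion σ g →
      x ∈ catalanRegion σ g' → ¬ g j < g' j := by
    intro g g' hg' hx hx' h
    have hj : g j < j := h.trans_le (hg' j)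
    have h1 := (hx ⟨g j, hj.trans j.2⟩ j hj).2.2 le_rfl
    have h2 := (hx' ⟨g j, hj.trans j.2⟩ j hj).2.1 h
    linarith
  exact le_antisymm (not_lt.1 (key hg hx' hx)) (not_lt.1 (key hg' hx hx'))

/-- Every ballot sequence is realised by an increasing sequence of reals, built point by point. -/
theorem exists_realisation (g : ℕ → ℕ) (n : ℕ) (hm : ∀ i j, i ≤ j → j < n → g i ≤ g j)
    (hd : ∀ j, j < n → g j ≤ j) :
    ∃ y : ℕ → ℝ, ∀ i j, i < j → j < n → y i < y j ∧
      (i < g j → y i + 1 < y j) ∧ (g j ≤ i → y j < y i + 1) := by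
  induction n with
  | zero => exact ⟨fun _ => 0, fun i j _ h => absurd h (Nat.not_lt_zero j)⟩
  | succ n ih =>
    obtain ⟨y, hy⟩ := ih (fun i j hij hj => hm i j hij (by omega)) fun j hj => hd j (by omega)
    obtain ⟨z, hz⟩ : ∃ z : ℝ, ∀ i, i < n → y i < z ∧
        (i < g n → y i + 1 < z) ∧ (g n ≤ i → z < y i + 1) := by
      have hmono : ∀ i j, i ≤ j → j < n → y i ≤ y j := by
        intro i j hij hj
        rcases hij.eq_or_lt with rfl | h
        · exact le_rfl
        · exact (hy i j h hj).1.le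
      obtain ⟨z, hlo, hhi⟩ := Finset.exists_between'
        ((Finset.range n).image y ∪ (Finset.range (g n)).image fun i => y i + 1)
        ((Finset.Ico (g n) n).image fun i => y i + 1) (by
          intro a ha b hb
          obtain ⟨j, hj, rfl⟩ := Finset.mem_image.1 hb
          rw [Finset.mem_Ico] at hj
          rcases Finset.mem_union.1 ha with ha | ha
          · obtain ⟨i, hi, rfl⟩ := Finset.mem_image.1 ha
            rw [Finset.mem_range] at hi
            rcases le_or_gt i j with hij | hij
            · linarith [hmono i j hij hj.2]
            · exact (hy j i hij hi).2.2 ((hm i n hi.le (by omega)).trans hj.1)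
          · obtain ⟨i, hi, rfl⟩ := Finset.mem_image.1 ha
            rw [Finset.mem_range] at hi
            linarith [(hy i j (by omega) hj.2).1])
      refine ⟨z, fun i hi => ⟨hlo _ ?_, fun h => hlo _ ?_, fun h => hhi _ ?_⟩⟩
      · exact Finset.mem_union_left _ (Finset.mem_image_of_mem _ (Finset.mem_range.2 hi))
      · exact Finset.mem_union_right _
          (Finset.mem_image_of_mem (fun i => y i + 1) (Finset.mem_range.2 h))
      · exact Finset.mem_image_of_mem (fun i => y i + 1) (Finset.mem_Ico.2 ⟨h, hi⟩)
    refine ⟨Function.update y n z, fun i j hij hj => ?_⟩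
    rw [Function.update_of_ne (show i ≠ n by omega)]
    rcases (Nat.lt_succ_iff.1 hj).eq_or_lt with rfl | hj
    · simpa using hz i hij
    · rw [Function.update_of_ne hj.ne]
      exact hy i j hij hj

theorem exists_sum_eq_zero_mem_catalanRegion {n : ℕ} (hn : 1 ≤ n) (σ : Equiv.Perm (Fin n))
    {g : Fin n → ℕ} (hg : g ∈ ballotSeq n n) : ∃ x ∈ catalanRegion σ g, ∑ i, x i = 0 := by
  obtain ⟨y, hy⟩ := exists_realisation (fun j => if h : j < n then g ⟨j, h⟩ else 0) n
    (fun i j hij hj => by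
      simpa only [hj, hij.trans_lt hj, dif_pos] using
        hg.1 (show (⟨i, hij.trans_lt hj⟩ : Fin n) ≤ ⟨j, hj⟩ from hij))
    (fun j hj => by simpa only [hj, dif_pos] using hg.2.1 ⟨j, hj⟩)
  set c : ℝ := (∑ i : Fin n, y (σ.symm i)) / n with hc
  refine ⟨fun i => y (σ.symm i) - c, fun i j hij => ?_, ?_⟩
  · obtain ⟨h1, h2, h3⟩ := hy i j hij j.2
    simp only [j.2, dif_pos, Fin.eta] at h2 h3
    simp only [Equiv.symm_apply_apply]
    exact ⟨by linarith, fun h => by linarith [h2 h], fun h => by linarith [h3 h]⟩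
  · have : (n : ℝ) ≠ 0 := by positivity
    rw [Finset.sum_sub_distrib, hc]
    simp only [Finset.sum_const, Finset.card_univ, Fintype.card_fin, nsmul_eq_mul]
    field_simp
    ring

/-- The number of regions of the arrangement `x_i - x_j = -1, 0, 1` (`i < j`) in
`V_{n-1}` equals `n! C_n`, where `C_n` is the `n`-th Catalan number. -/
theorem stmt7 (n : ℕ) (hn : 1 ≤ n) :
    numRegions {x : Fin n → ℝ | (∑ i, x i) = 0 ∧
        ∀ i j : Fin n, i < j →
          (x i - x j ≠ -1 ∧ x i - x j ≠ 0 ∧ x i - x j ≠ 1)} =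
      n.factorial * catalan n := by
  have hcard : Nat.card (Equiv.Perm (Fin n) × ballotSeq n n) = n.factorial * catalan n := by
    rw [Nat.card_prod, Nat.card_perm, Nat.card_fin, Nat.card_coe_set_eq, ncard_ballotSeq_self]
  rw [← hcard, numRegions]
  refine card_connectedComponents_eq_of_partition
    (fun t => Subtype.val ⁻¹' catalanRegion t.1 (t.2 : Fin n → ℕ)) ?_ ?_ ?_ ?_ ?_
  · exact fun t => (isOpen_catalanRegion _ _).preimage continuous_subtype_val
  · intro t
    rw [← Topology.IsInducing.subtypeVal.isPreconnected_image, Subtype.image_preimage_coe]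
    have hconv : Convex ℝ ({x : Fin n → ℝ | ∑ i, x i = 0} ∩ catalanRegion t.1 t.2) := by
      refine Convex.inter ?_ (convex_catalanRegion _ _)
      intro x hx y hy a b _ _ _
      simp only [Set.mem_ofPred_eq] at hx hy
      simp [Finset.sum_add_distrib, ← Finset.mul_sum, hx, hy]
    convert hconv.isPreconnected using 1
    ext x
    exact ⟨fun h => ⟨h.1.1, h.2⟩,
      fun h => ⟨⟨h.1, fun i j hij => sub_ne_of_mem_catalanRegion h.2 hij.ne⟩, h.2⟩⟩
  · rintro ⟨σ, g, hg⟩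
    obtain ⟨x, hx, hsum⟩ := exists_sum_eq_zero_mem_catalanRegion hn σ hg
    exact ⟨⟨x, hsum, fun i j hij => sub_ne_of_mem_catalanRegion hx hij.ne⟩, hx⟩
  · rintro ⟨x, -, hx⟩
    obtain ⟨σ, g, hg, hmem⟩ := exists_mem_catalanRegion hx
    exact ⟨⟨σ, g, hg⟩, hmem⟩
  · rintro x ⟨σ, g, hg⟩ ⟨σ', g', hg'⟩ h h'
    obtain ⟨rfl, rfl⟩ := catalanRegion_unique hg.2.1 hg'.2.1 h h'
    rfl
end

section
/- Fix m ≥ 1 and distinct positive real numbers a_1, ..., a_m. For n ≥ 1 let C_{n-1} be the arrangement in V_{n-1} with hyperplanes x_i − x_j = a_s for all i ≠ j and all 1 ≤ s ≤ m; by convention r(C_{-1}) = 1. The symmetric group S_n acts on V_{n-1} by permuting coordinates, and this action permutes the regions of C_{n-1}. Let σ ∈ S_n be a permutation with exactly k cycles. Then the number of regions R of C_{n-1} with σ(R) = R equals r(C_{k-1}). -/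
/-- The complement of the arrangement `x i - x j = a s` in the sum-zero hyperplane. -/
def arrangementComplement {ι κ : Type*} [Fintype ι] (a : κ → ℝ) : Set (ι → ℝ) :=
  {x | (∑ i, x i) = 0 ∧ ∀ i j : ι, i ≠ j → ∀ s, x i - x j ≠ a s}

/-- Two points lie on the same side of every hyperplane `x i - x j = a s`. -/
def SameSide {ι κ : Type*} (a : κ → ℝ) (x y : ι → ℝ) : Prop :=
  ∀ i j : ι, i ≠ j → ∀ s, (x i - x j < a s ↔ y i - y j < a s)

/-- The points of the complement lying on the same side as `x` of every hyperplane. -/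
def sideCell {ι κ : Type*} [Fintype ι] (a : κ → ℝ) (x : ι → ℝ) : Set (ι → ℝ) :=
  {y | y ∈ arrangementComplement a ∧ SameSide a x y}

section Regions

variable {ι κ : Type*} {a : κ → ℝ}

theorem SameSide.refl (x : ι → ℝ) : SameSide a x x := fun _ _ _ _ => Iff.rfl

theorem SameSide.symm {x y : ι → ℝ} (h : SameSide a x y) : SameSide a y x :=
  fun i j hij s => (h i j hij s).symm

theorem SameSide.trans {x y z : ι → ℝ} (h : SameSide a x y) (h' : SameSide a y z) :
    SameSide a x z :=
  fun i j hij s => (h i j hij s).trans (h' i j hij s)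

theorem SameSide.comp_injective {ι' : Type*} {x y : ι → ℝ} (h : SameSide a x y) {f : ι' → ι}
    (hf : Function.Injective f) : SameSide a (x ∘ f) (y ∘ f) :=
  fun i j hij s => h (f i) (f j) (hf.ne hij) s

theorem SameSide.of_sub_eq {x y : ι → ℝ} (h : ∀ i j, x i - x j = y i - y j) :
    SameSide a x y :=
  fun i j _ s => by rw [h i j]

variable [Fintype ι]

theorem comp_perm_mem_arrangementComplement {x : ι → ℝ} (hx : x ∈ arrangementComplement a)
    (σ : Equiv.Perm ι) : x ∘ σ ∈ arrangementComplement a := by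
  refine ⟨?_, fun i j hij s => hx.2 (σ i) (σ j) (σ.injective.ne hij) s⟩
  rw [← hx.1]
  exact Equiv.sum_comp σ x

theorem convex_sideCell (x : ι → ℝ) : Convex ℝ (sideCell a x) := by
  rintro y ⟨hy, hxy⟩ z ⟨hz, hxz⟩ b c hb hc hbc
  have key : ∀ i j, (b • y + c • z) i - (b • y + c • z) j
      = b * (y i - y j) + c * (z i - z j) := by
    intro i j
    simp only [Pi.add_apply, Pi.smul_apply, smul_eq_mul]
    ring
  have lt_case : ∀ i j s, y i - y j < a s → z i - z j < a s →
      b * (y i - y j) + c * (z i - z j) < a s := fun i j s h1 h2 =>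
    (convex_Iio (a s)) h1 h2 hb hc hbc
  have gt_case : ∀ i j s, a s < y i - y j → a s < z i - z j →
      a s < b * (y i - y j) + c * (z i - z j) := fun i j s h1 h2 =>
    (convex_Ioi (a s)) h1 h2 hb hc hbc
  refine ⟨⟨?_, ?_⟩, ?_⟩
  · simp only [Pi.add_apply, Pi.smul_apply, smul_eq_mul, Finset.sum_add_distrib,
      ← Finset.mul_sum, hy.1, hz.1, mul_zero, add_zero]
  · intro i j hij s
    rw [key]
    have h := (hxy i j hij s).symm.trans (hxz i j hij s)
    rcases lt_or_gt_of_ne (hy.2 i j hij s) with h1 | h1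
    · exact (lt_case i j s h1 (h.1 h1)).ne
    · refine (gt_case i j s h1 (lt_of_le_of_ne ?_ (hz.2 i j hij s).symm)).ne'
      exact not_lt.1 fun h2 => h1.not_gt (h.2 h2)
  · intro i j hij s
    rw [key, hxy i j hij s]
    have h := (hxy i j hij s).symm.trans (hxz i j hij s)
    refine ⟨fun h1 => lt_case i j s h1 (h.1 h1), fun h3 => ?_⟩
    by_contra h1
    have h2 : a s < z i - z j :=
      lt_of_le_of_ne (not_lt.1 fun h2 => h1 (h.2 h2)) (hz.2 i j hij s).symm
    have h1' : a s < y i - y j := lt_of_le_of_ne (not_lt.1 h1) (hy.2 i j hij s).symm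
    exact h3.not_gt (gt_case i j s h1' h2)

theorem connectedComponentIn_arrangementComplement {x : ι → ℝ}
    (hx : x ∈ arrangementComplement a) :
    connectedComponentIn (arrangementComplement a) x = sideCell a x := by
  apply Set.Subset.antisymm
  · intro y hy
    refine ⟨connectedComponentIn_subset _ _ hy, fun i j hij s => ?_⟩
    have hpre : IsPreconnected
        ((fun z : ι → ℝ => z i - z j) '' connectedComponentIn (arrangementComplement a) x) :=
      isPreconnected_connectedComponentIn.image _ (by fun_prop)
    have hne : a s ∉
        (fun z : ι → ℝ => z i - z j) '' connectedComponentIn (arrangementComplement a) x := by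
      rintro ⟨z, hz, h⟩
      exact (connectedComponentIn_subset _ _ hz).2 i j hij s h
    have hxm := Set.mem_image_of_mem (fun z : ι → ℝ => z i - z j) (mem_connectedComponentIn hx)
    have hym := Set.mem_image_of_mem (fun z : ι → ℝ => z i - z j) hy
    constructor
    · intro h
      by_contra h'
      exact hne (hpre.ordConnected.out hxm hym ⟨h.le, not_lt.1 h'⟩)
    · intro h
      by_contra h'
      exact hne (hpre.ordConnected.out hym hxm ⟨h.le, not_lt.1 h'⟩)
  · exact (convex_sideCell x).isPreconnected.subset_connectedComponentIn ⟨hx, SameSide.refl x⟩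
      fun y hy => hy.1

theorem connectedComponents_coe_eq_coe_iff_sameSide
    (x y : (arrangementComplement a : Set (ι → ℝ))) :
    (x : ConnectedComponents (arrangementComplement a : Set (ι → ℝ))) = y ↔
      SameSide a (x : ι → ℝ) y := by
  have h := connectedComponentIn_eq_image y.2
  rw [connectedComponentIn_arrangementComplement y.2] at h
  rw [ConnectedComponents.coe_eq_coe', ← Subtype.val_injective.mem_set_image, ← h]
  exact ⟨fun h => h.2.symm, fun h => ⟨x.2, h.symm⟩⟩

theorem sideCell_eq_sideCell_iff {x y : ι → ℝ} (hx : x ∈ arrangementComplement a) :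
    sideCell a x = sideCell a y ↔ SameSide a x y := by
  constructor
  · intro h
    have hm : x ∈ sideCell a y := h ▸ ⟨hx, SameSide.refl x⟩
    exact hm.2.symm
  · intro h
    ext z
    exact ⟨fun hz => ⟨hz.1, h.symm.trans hz.2⟩, fun hz => ⟨hz.1, h.trans hz.2⟩⟩

theorem image_comp_perm_sideCell {x : ι → ℝ} {σ : Equiv.Perm ι} (h : SameSide a (x ∘ σ) x) :
    (fun y : ι → ℝ => y ∘ σ) '' sideCell a x = sideCell a x := by
  apply Set.Subset.antisymm
  · rintro _ ⟨y, hy, rfl⟩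
    exact ⟨comp_perm_mem_arrangementComplement hy.1 σ,
      h.symm.trans (hy.2.comp_injective σ.injective)⟩
  · intro y hy
    refine ⟨y ∘ σ.symm, ⟨comp_perm_mem_arrangementComplement hy.1 _, ?_⟩, ?_⟩
    · have h' := (h.trans hy.2).comp_injective σ.symm.injective
      rwa [Function.comp_assoc, Equiv.self_comp_symm, Function.comp_id] at h'
    · simp [Function.comp_assoc]

/-- A region stable under `σ` contains a point fixed by `σ`. -/
theorem exists_fixed_mem_sideCell {x : ι → ℝ} (hx : x ∈ arrangementComplement a)
    {σ : Equiv.Perm ι} (h : (fun y : ι → ℝ => y ∘ σ) '' sideCell a x = sideCell a x) :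
    ∃ z ∈ sideCell a x, ∀ i, z (σ i) = z i := by
  have hpow : ∀ t : ℕ, x ∘ (σ ^ t : Equiv.Perm ι) ∈ sideCell a x := by
    intro t
    induction t with
    | zero => exact ⟨hx, SameSide.refl x⟩
    | succ t ih =>
      rw [pow_succ, Equiv.Perm.coe_mul, ← Function.comp_assoc, ← h]
      exact Set.mem_image_of_mem (fun y : ι → ℝ => y ∘ σ) ih
  have hN : (orderOf σ : ℝ) ≠ 0 := by exact_mod_cast (orderOf_pos σ).ne'
  refine ⟨∑ t ∈ Finset.range (orderOf σ), (orderOf σ : ℝ)⁻¹ • (x ∘ (σ ^ t : Equiv.Perm ι)),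
    (convex_sideCell x).sum_mem (fun _ _ => by positivity) (by simp [hN]) fun t _ => hpow t,
    fun i => ?_⟩
  simp only [Finset.sum_apply, Pi.smul_apply, Function.comp_apply, ← Equiv.Perm.mul_apply,
    ← pow_succ]
  have h1 := Finset.sum_range_succ (fun t => (orderOf σ : ℝ)⁻¹ • x ((σ ^ t) i)) (orderOf σ)
  have h2 := Finset.sum_range_succ' (fun t => (orderOf σ : ℝ)⁻¹ • x ((σ ^ t) i)) (orderOf σ)
  rw [h1, pow_orderOf_eq_one, pow_zero] at h2
  exact (add_right_cancel h2).symm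

/-- The coordinates of `x` shifted by a constant so that they sum to zero. -/
noncomputable def centered (x : ι → ℝ) : ι → ℝ :=
  fun i => x i - (∑ j, x j) / Fintype.card ι

theorem sum_centered [Nonempty ι] (x : ι → ℝ) : ∑ i, centered x i = 0 := by
  simp [centered, mul_div_cancel₀]

theorem centered_sub (x : ι → ℝ) (i j : ι) : centered x i - centered x j = x i - x j := by
  simp [centered]

end Regions

section Fixed

variable {ι ι' κ : Type*} [Fintype ι] [Fintype ι'] {a : κ → ℝ}

theorem centered_comp_mem_arrangementComplement [Nonempty ι] (ha : ∀ s, 0 < a s) (p : ι → ι')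
    {x : ι' → ℝ} (hx : x ∈ arrangementComplement a) :
    centered (x ∘ p) ∈ arrangementComplement a := by
  refine ⟨sum_centered _, fun i j _ s => ?_⟩
  rw [centered_sub]
  by_cases h : p i = p j
  · simpa [h] using (ha s).ne
  · exact hx.2 _ _ h s

theorem sameSide_centered_comp_iff {β : Type*} {p : ι → β}
    (hp : Function.Surjective p) {x y : β → ℝ} :
    SameSide a (centered (x ∘ p)) (centered (y ∘ p)) ↔ SameSide a x y := by
  constructor
  · intro h c d hcd s
    obtain ⟨i, rfl⟩ := hp c
    obtain ⟨j, rfl⟩ := hp d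
    have hij := h i j (fun e => hcd (congrArg p e)) s
    rwa [centered_sub, centered_sub] at hij
  · intro h i j _ s
    rw [centered_sub, centered_sub]
    by_cases e : p i = p j
    · simp [e]
    · exact h _ _ e s

/-- The regions stable under `σ` correspond to the regions of the arrangement indexed by the
fibres of `p`, where `p` identifies exactly the indices on which `σ`-invariant functions agree. -/
theorem card_stable_regions_eq [Nonempty ι] (ha : ∀ s, 0 < a s) (σ : Equiv.Perm ι) {p : ι → ι'}
    (hp : Function.Surjective p) (hpσ : ∀ i, p (σ i) = p i)
    (hfix : ∀ z : ι → ℝ, (∀ i, z (σ i) = z i) → ∀ i j, p i = p j → z i = z j) :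
    Nat.card {R : Set (ι → ℝ) //
        (∃ x ∈ (arrangementComplement a : Set (ι → ℝ)),
          R = connectedComponentIn (arrangementComplement a) x) ∧
        (fun y : ι → ℝ => y ∘ σ) '' R = R} =
      numRegions (arrangementComplement a : Set (ι' → ℝ)) := by
  have hmem {x : ι' → ℝ} (hx : x ∈ arrangementComplement a) :
      centered (x ∘ p) ∈ arrangementComplement a :=
    centered_comp_mem_arrangementComplement ha p hx
  let g : ↥(arrangementComplement a : Set (ι' → ℝ)) → {R : Set (ι → ℝ) //
        (∃ x ∈ (arrangementComplement a : Set (ι → ℝ)),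
          R = connectedComponentIn (arrangementComplement a) x) ∧
        (fun y : ι → ℝ => y ∘ σ) '' R = R} := fun x =>
    ⟨sideCell a (centered (x.1 ∘ p)),
      ⟨_, hmem x.2, (connectedComponentIn_arrangementComplement (hmem x.2)).symm⟩,
      image_comp_perm_sideCell (SameSide.of_sub_eq fun i j => by simp [centered, hpσ])⟩
  have hg : ∀ x y, g x = g y ↔
      (x : ConnectedComponents (arrangementComplement a : Set (ι' → ℝ))) = y := fun x y => by
    rw [connectedComponents_coe_eq_coe_iff_sameSide, ← sameSide_centered_comp_iff hp,
      ← sideCell_eq_sideCell_iff (hmem x.2), Subtype.ext_iff]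
  have hsurj : Function.Surjective g := by
    rintro ⟨R, ⟨x, hx, rfl⟩, hR⟩
    have hcell := connectedComponentIn_arrangementComplement hx
    rw [hcell] at hR
    obtain ⟨z, hz, hzσ⟩ := exists_fixed_mem_sideCell hx hR
    have : Nonempty ι' := Nonempty.map p inferInstance
    let r := Function.surjInv hp
    have hr : ∀ c, p (r c) = c := Function.surjInv_eq hp
    refine ⟨⟨centered (z ∘ r), sum_centered _, fun c d hcd s => ?_⟩, Subtype.ext ?_⟩
    · rw [centered_sub]
      exact hz.1.2 _ _ (fun e => hcd (by rw [← hr c, ← hr d, e])) s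
    · change sideCell a (centered (centered (z ∘ r) ∘ p)) =
        connectedComponentIn (arrangementComplement a) x
      rw [hcell, eq_comm, sideCell_eq_sideCell_iff hx]
      refine hz.2.trans (SameSide.of_sub_eq fun i j => ?_)
      rw [centered_sub, Function.comp_apply, Function.comp_apply, centered_sub,
        Function.comp_apply, Function.comp_apply, hfix z hzσ _ _ (hr (p i)),
        hfix z hzσ _ _ (hr (p j))]
  rw [numRegions]
  symm
  refine Nat.card_eq_of_bijective
    (Quotient.lift g fun x y h => (hg x y).2 (Quotient.sound h)) ⟨?_, ?_⟩
  · intro c d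
    induction c using Quotient.inductionOn
    induction d using Quotient.inductionOn
    exact (hg _ _).1
  · exact fun R => (hsurj R).imp' (fun x => ⟦x⟧) fun _ h => h

end Fixed

/-- Let `C_{n-1}` be the arrangement `x_i - x_j = a_s` (`i ≠ j`, `1 ≤ s ≤ m`) in
`V_{n-1}`, with `a_1, ..., a_m` distinct positive reals.  If `σ` is a permutation of
`{1, ..., n}` with exactly `k` cycles, then the number of regions `R` of `C_{n-1}` with
`σ(R) = R` equals the total number of regions of `C_{k-1}`. -/
theorem stmt8 (m : ℕ) (hm : 1 ≤ m) (a : Fin m → ℝ) (hpos : ∀ s, 0 < a s)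
    (hdist : Function.Injective a) (n : ℕ) (hn : 1 ≤ n)
    (σ : Equiv.Perm (Fin n)) (k : ℕ) (hk : cyclesCount σ = k) :
    Nat.card {R : Set (Fin n → ℝ) //
        (∃ x ∈ {x : Fin n → ℝ | (∑ i, x i) = 0 ∧
            ∀ i j : Fin n, i ≠ j → ∀ s, x i - x j ≠ a s},
          R = connectedComponentIn
            {x : Fin n → ℝ | (∑ i, x i) = 0 ∧
              ∀ i j : Fin n, i ≠ j → ∀ s, x i - x j ≠ a s} x) ∧
        (fun y : Fin n → ℝ => y ∘ σ) '' R = R} =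
      numRegions {x : Fin k → ℝ | (∑ i, x i) = 0 ∧
        ∀ i j : Fin k, i ≠ j → ∀ s, x i - x j ≠ a s} := by
  have : Nonempty (Fin n) := ⟨⟨0, hn⟩⟩
  have hk' : Nat.card (MulAction.orbitRel.Quotient (Subgroup.zpowers σ) (Fin n)) = k := hk
  let e := Finite.equivFinOfCardEq hk'
  let p : Fin n → Fin k := fun i => e (Quotient.mk'' i)
  have hp : ∀ i j, p i = p j ↔ i ∈ MulAction.orbit (Subgroup.zpowers σ) j := fun i j => by
    rw [e.injective.eq_iff, Quotient.eq'', MulAction.orbitRel_apply]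
  refine card_stable_regions_eq (p := p) hpos σ
    (e.surjective.comp Quotient.mk''_surjective) (fun i => ?_) fun z hz i j hij => ?_
  · exact (hp _ _).2 ⟨⟨σ, Subgroup.mem_zpowers σ⟩, rfl⟩
  · obtain ⟨⟨g, hg⟩, rfl⟩ := (hp i j).1 hij
    obtain ⟨t, rfl⟩ := mem_powers_iff_mem_zpowers.2 hg
    change z ((σ ^ t) j) = z j
    induction t with
    | zero => rfl
    | succ t ih =>
      rw [pow_succ', Equiv.Perm.mul_apply, hz]
      exact ih (pow_mem (Subgroup.mem_zpowers σ) t)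
        ((hp _ _).2 ⟨⟨σ ^ t, pow_mem (Subgroup.mem_zpowers σ) t⟩, rfl⟩)
end
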